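/- (Duality of graphical functions, analytic core.) Let G and G' be connected Feynman graphs, each with external vertex set {0, 1, z}, and let φ : E_G → E_{G'} be a bijection of their edge sets such that the weights satisfy λ·ν'_{φ(e)} = d/2 − λ·ν_e and 0 < λ·ν_e < d/2 for every edge e of G. Assume that both G and G' are ultraviolet convergent and infrared convergent, that M_G = d/2 and M_{G'} = d/2, and that for each pair {i,j} ⊂ {0,1,z} the polynomial identity Ψ̃_G^{p(i,j)}(α) = Ψ_{G'}^{p(i,j)}(α ∘ φ^{−1}) holds upon identifying the variable α_e with α_{φ(e)}. Then for every z ∈ ℂ∖{0,1}: f_{G'}(z) = f_G(z) · ∏_{e ∈ E_G} Γ(λν_e) / Γ(d/2 − λν_e). -/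

import Mathlib

open scoped Classical ENNReal
open MeasureTheory

noncomputable section

/-- A Feynman graph with vertices `Fin nV`, edges `Fin nE` (each edge has two
distinct endpoints, multiple edges allowed), a set of external vertices and
real edge weights. -/
structure FeynmanGraph (nV nE : ℕ) where
  ends : Fin nE → Fin nV × Fin nV
  ends_ne : ∀ e, (ends e).1 ≠ (ends e).2
  ext : Finset (Fin nV)
  ν : Fin nE → ℝ

/-- `λ = d/2 - 1`. -/
def lam (d : ℕ) : ℝ := (d : ℝ) / 2 - 1

namespace FeynmanGraph

variable {nV nE : ℕ} (G : FeynmanGraph nV nE)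

/-- The edge `e` is incident to the vertex `v`. -/
def Incident (e : Fin nE) (v : Fin nV) : Prop :=
  (G.ends e).1 = v ∨ (G.ends e).2 = v

/-- The edge `e` joins the vertices `u` and `v`. -/
def Joins (e : Fin nE) (u v : Fin nV) : Prop :=
  G.ends e = (u, v) ∨ G.ends e = (v, u)

/-- The internal vertices of `G`. -/
def intVerts : Finset (Fin nV) := Finset.univ.filter (fun v => v ∉ G.ext)

/-- The simple graph on the vertices of `G` induced by a subset `F` of the edges. -/
def edgeGraph (F : Finset (Fin nE)) : SimpleGraph (Fin nV) :=
  SimpleGraph.fromRel (fun u v => ∃ e ∈ F, G.Joins e u v)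

/-- `F` is a spanning forest of `G` compatible with the collection `p` of pairwise
disjoint vertex sets: `F` is acyclic (as a set of multigraph edges), the graph
`(V, F)` has exactly `p.card` connected components, and distinct parts of `p` lie in
distinct components.  (Acyclicity together with the component count is expressed by
the edge count `F.card + p.card = nV`.) -/
def IsForest (p : Finset (Finset (Fin nV))) (F : Finset (Fin nE)) : Prop :=
  F.card + p.card = nV ∧
  Nat.card (G.edgeGraph F).ConnectedComponent = p.card ∧
  (∀ P ∈ p, ∀ u ∈ P, ∀ v ∈ P, (G.edgeGraph F).Reachable u v) ∧
  (∀ P ∈ p, ∀ Q ∈ p, P ≠ Q → ∀ u ∈ P, ∀ v ∈ Q, ¬ (G.edgeGraph F).Reachable u v)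

/-- The set `𝓕_G^p` of spanning forests compatible with `p`. -/
def forests (p : Finset (Finset (Fin nV))) : Finset (Finset (Fin nE)) :=
  Finset.univ.filter (fun F => G.IsForest p F)

/-- The dual spanning forest polynomial `Ψ̃_G^p`, evaluated at `α`. -/
def dualForestPoly (p : Finset (Finset (Fin nV))) (α : Fin nE → ℝ) : ℝ :=
  ∑ F ∈ G.forests p, ∏ e ∈ F, α e

/-- The spanning forest polynomial `Ψ_G^p`, evaluated at `α`. -/
def forestPoly (p : Finset (Finset (Fin nV))) (α : Fin nE → ℝ) : ℝ :=
  ∑ F ∈ G.forests p, ∏ e ∈ Finset.univ \ F, α e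

/-- The partition of the external vertices into singletons. -/
def singlePart : Finset (Finset (Fin nV)) := G.ext.image (fun v => {v})

/-- The collection `p(i,j)` consisting of `{i, j}` together with the singletons of the
remaining external vertices. -/
def pairPart (i j : Fin nV) : Finset (Finset (Fin nV)) :=
  insert ({i, j} : Finset (Fin nV)) (((G.ext.erase i).erase j).image (fun v => {v}))

/-- `Ψ̃_G`, evaluated at `α`. -/
def psiTilde (α : Fin nE → ℝ) : ℝ := G.dualForestPoly G.singlePart α

/-- `Φ̃_G(α, x) = Σ_{i<j external} ‖x_i - x_j‖² Ψ̃_G^{p(i,j)}(α)`. -/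
def phiTilde {d : ℕ} (x : Fin nV → EuclideanSpace ℝ (Fin d)) (α : Fin nE → ℝ) : ℝ :=
  ∑ i ∈ G.ext, ∑ j ∈ G.ext.filter (fun j => i < j),
    ‖x i - x j‖ ^ 2 * G.dualForestPoly (G.pairPart i j) α

/-- Positions of all vertices: external vertices are placed according to `x`,
internal vertices according to `y`. -/
def assemble {E : Type*} (x : Fin nV → E) (y : {v : Fin nV // v ∉ G.ext} → E) :
    Fin nV → E :=
  fun v => if h : v ∉ G.ext then y ⟨v, h⟩ else x v

/-- The position space Feynman integral
`f_G(x) = ∫ ∏_{v internal} d^d x_v/π^{d/2} ∏_e ‖x_{u(e)} - x_{w(e)}‖^{-2λν_e}`,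
a Lebesgue integral of a nonnegative function, with values in `[0,∞]`.  Only the
external components of `x` matter. -/
def posIntegral (d : ℕ) (x : Fin nV → EuclideanSpace ℝ (Fin d)) : ℝ≥0∞ :=
  (∫⁻ y : {v : Fin nV // v ∉ G.ext} → EuclideanSpace ℝ (Fin d),
      ENNReal.ofReal (∏ e,
        ‖G.assemble x y (G.ends e).1 - G.assemble x y (G.ends e).2‖ ^ (-(2 * lam d * G.ν e)))) /
    ENNReal.ofReal (Real.pi ^ ((d : ℝ) / 2 * (G.intVerts.card : ℝ)))

/-- The standard positions of the three external vertices `0`, `1`, `z`. -/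
def extPos (d : ℕ) (v0 v1 vz : Fin nV) (z : ℂ) : Fin nV → EuclideanSpace ℝ (Fin d) :=
  fun v =>
    if v = v0 then 0
    else if v = v1 then (WithLp.toLp 2 (fun i : Fin d => if (i : ℕ) = 0 then 1 else 0))
    else if v = vz then
      (WithLp.toLp 2 (fun i : Fin d => if (i : ℕ) = 0 then z.re else if (i : ℕ) = 1 then z.im else 0))
    else 0

/-- The graphical function `f_G(z)` of a graph with the three external vertices
`v0`, `v1`, `vz`. -/
def graphicalFn (d : ℕ) (v0 v1 vz : Fin nV) (z : ℂ) : ℝ≥0∞ :=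
  G.posIntegral d (extPos d v0 v1 vz z)

/-- The edges of `G` having both endpoints in `Vg`. -/
def edgesWithin (Vg : Finset (Fin nV)) : Finset (Fin nE) :=
  Finset.univ.filter (fun e => (G.ends e).1 ∈ Vg ∧ (G.ends e).2 ∈ Vg)

/-- Ultraviolet convergence. -/
def UVConvergent (d : ℕ) : Prop :=
  ∀ Vg : Finset (Fin nV), 2 ≤ Vg.card → (Vg ∩ G.ext).card ≤ 1 →
    lam d * ∑ e ∈ G.edgesWithin Vg, G.ν e < (d : ℝ) / 2 * ((Vg.card : ℝ) - 1)

/-- `(Vg, Eg)` is a subgraph of `G`. -/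
def IsSubgraph (Vg : Finset (Fin nV)) (Eg : Finset (Fin nE)) : Prop :=
  ∀ e ∈ Eg, (G.ends e).1 ∈ Vg ∧ (G.ends e).2 ∈ Vg

/-- `v` is a `g`-internal vertex of the subgraph `g = (Vg, Eg)`. -/
def GInternal (Vg : Finset (Fin nV)) (Eg : Finset (Fin nE)) (v : Fin nV) : Prop :=
  v ∉ G.ext ∧ v ∈ Vg ∧ ∀ e, G.Incident e v → e ∈ Eg

/-- The set of `g`-internal vertices of the subgraph `g = (Vg, Eg)`. -/
def gInternalSet (Vg : Finset (Fin nV)) (Eg : Finset (Fin nE)) : Finset (Fin nV) :=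
  Finset.univ.filter (fun v => G.GInternal Vg Eg v)

/-- Infrared convergence. -/
def IRConvergent (d : ℕ) : Prop :=
  ∀ Vg : Finset (Fin nV), ∀ Eg : Finset (Fin nE), G.IsSubgraph Vg Eg →
    0 < (G.gInternalSet Vg Eg).card →
    (∀ e ∈ Eg, G.GInternal Vg Eg (G.ends e).1 ∨ G.GInternal Vg Eg (G.ends e).2) →
    (d : ℝ) / 2 * ((G.gInternalSet Vg Eg).card : ℝ) < lam d * ∑ e ∈ Eg, G.ν e

/-- The superficial degree of divergence `M_G = λ ν_G - (d/2)·V_int`. -/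
def Mdeg (d : ℕ) : ℝ := lam d * ∑ e, G.ν e - (d : ℝ) / 2 * (G.intVerts.card : ℝ)

end FeynmanGraph

/-- Cauchy–Binet type expansion of the determinant of a weighted Gram matrix. -/
theorem det_weighted_gram {N E : Type*} [Fintype N] [DecidableEq N] [Fintype E] [DecidableEq E]
    (b : E → N → ℝ) (α : E → ℝ) :
    (Matrix.of fun v w => ∑ e, α e * (b e v * b e w)).det =
      ∑ F ∈ Finset.univ.powersetCard (Fintype.card N),
        (∏ e ∈ F, α e) * (Matrix.of fun v w => ∑ e ∈ F, b e v * b e w).det := by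
  set t : (N → E) → ℝ := fun f =>
    (∏ v, b (f v) v) * (Matrix.of fun v w => b (f v) w).det with ht
  have expand : ∀ β : E → ℝ, (Matrix.of fun v w => ∑ e, β e * (b e v * b e w)).det =
      ∑ f : N → E, (∏ v, β (f v)) * t f := by
    intro β
    have h1 : (Matrix.of fun v w => ∑ e, β e * (b e v * b e w)) =
        fun v => ∑ e, (β e * b e v) • b e := by
      funext v w
      simp [mul_assoc]
    have h2 := (Matrix.detRowAlternating (R := ℝ) (n := N)).toMultilinearMap.map_sum
      (fun (v : N) (e : E) => (β e * b e v) • b e)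
    rw [h1]
    refine h2.trans (Finset.sum_congr rfl fun f _ => ?_)
    rw [MultilinearMap.map_smul_univ, Finset.prod_mul_distrib, smul_eq_mul, mul_assoc]
    rfl
  have tzero : ∀ f : N → E, ¬ Function.Injective f → t f = 0 := by
    intro f hf
    simp only [Function.Injective, not_forall] at hf
    obtain ⟨v, w, hvw, hne⟩ := hf
    simp only [ht]
    rw [Matrix.det_zero_of_row_eq hne, mul_zero]
    funext x
    simp [hvw]
  have onF : ∀ F ∈ (Finset.univ : Finset E).powersetCard (Fintype.card N),
      (Matrix.of fun v w => ∑ e ∈ F, b e v * b e w).det =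
        ∑ f ∈ (Finset.univ.filter fun f : N → E => Function.Injective f) with
          Finset.univ.image f = F, t f := by
    intro F hF
    have hcard := (Finset.mem_powersetCard.1 hF).2
    have h1 : (Matrix.of fun v w => ∑ e ∈ F, b e v * b e w) =
        Matrix.of fun v w => ∑ e, (if e ∈ F then (1 : ℝ) else 0) * (b e v * b e w) := by
      ext v w
      simp [Finset.sum_ite_mem]
    rw [h1, expand, Finset.filter_filter, Finset.sum_filter]
    refine Finset.sum_congr rfl fun f _ => ?_
    by_cases hf : Function.Injective f
    · by_cases hm : ∀ v, f v ∈ F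
      · have himg : Finset.univ.image f = F := by
          apply Finset.eq_of_subset_of_card_le
          · intro e he
            obtain ⟨v, -, rfl⟩ := Finset.mem_image.1 he
            exact hm v
          · rw [Finset.card_image_of_injective _ hf, hcard, Finset.card_univ]
        simp [hf, himg, hm]
      · have himg : Finset.univ.image f ≠ F := by
          rintro rfl
          exact hm fun v => Finset.mem_image_of_mem _ (Finset.mem_univ _)
        push Not at hm
        obtain ⟨v, hv⟩ := hm
        rw [if_neg (fun h => himg h.2), Finset.prod_eq_zero (Finset.mem_univ v) (by simp [hv]),
          zero_mul]
    · simp [hf, tzero f hf]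
  have hmaps : ∀ f ∈ (Finset.univ.filter fun f : N → E => Function.Injective f),
      Finset.univ.image f ∈ (Finset.univ : Finset E).powersetCard (Fintype.card N) := by
    intro f hf
    rw [Finset.mem_powersetCard]
    refine ⟨Finset.subset_univ _, ?_⟩
    rw [Finset.card_image_of_injective _ (Finset.mem_filter.1 hf).2, Finset.card_univ]
  have hinj : ∑ f : N → E, (∏ v, α (f v)) * t f =
      ∑ f with Function.Injective f, (∏ v, α (f v)) * t f := by
    refine (Finset.sum_subset (Finset.filter_subset _ _) fun f _ hf => ?_).symm
    rw [tzero f (by simpa using hf), mul_zero]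
  rw [expand, hinj, ← Finset.sum_fiberwise_of_maps_to hmaps]
  refine Finset.sum_congr rfl fun F hF => ?_
  rw [onF F hF, Finset.mul_sum]
  refine Finset.sum_congr rfl fun f hf => ?_
  obtain ⟨hfinj, rfl⟩ := Finset.mem_filter.1 hf
  rw [Finset.prod_image (Finset.mem_filter.1 hfinj).2.injOn]

namespace FeynmanGraph

variable {nV nE : ℕ} (G : FeynmanGraph nV nE)

/-- The signed incidence matrix of `G`. -/
def inc (e : Fin nE) (v : Fin nV) : ℤ :=
  (if (G.ends e).1 = v then 1 else 0) - (if (G.ends e).2 = v then 1 else 0)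

theorem edgeGraph_adj {F : Finset (Fin nE)} {e : Fin nE} (he : e ∈ F) :
    (G.edgeGraph F).Adj (G.ends e).1 (G.ends e).2 := by
  rw [edgeGraph, SimpleGraph.fromRel_adj]
  exact ⟨G.ends_ne e, Or.inl ⟨e, he, Or.inl rfl⟩⟩

theorem exists_edge_of_adj {F : Finset (Fin nE)} {u v : Fin nV} (h : (G.edgeGraph F).Adj u v) :
    ∃ e ∈ F, G.ends e = (u, v) ∨ G.ends e = (v, u) := by
  rw [edgeGraph, SimpleGraph.fromRel_adj] at h
  rcases h.2 with ⟨e, he, h⟩ | ⟨e, he, h⟩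
  · exact ⟨e, he, h⟩
  · exact ⟨e, he, h.symm⟩

theorem exists_inc_combination {F : Finset (Fin nE)} {u v : Fin nV}
    (h : (G.edgeGraph F).Reachable u v) :
    ∃ c : Fin nE → ℤ, ∀ w, ∑ e ∈ F, c e * G.inc e w =
      (if u = w then 1 else 0) - (if v = w then 1 else 0) := by
  obtain ⟨p⟩ := h
  induction p with
  | nil => exact ⟨0, by simp⟩
  | cons hadj _ ih =>
    obtain ⟨c, hc⟩ := ih
    obtain ⟨e, he, h | h⟩ := G.exists_edge_of_adj hadj
    · refine ⟨c + Pi.single e 1, fun w => ?_⟩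
      simp only [Pi.add_apply, add_mul, Finset.sum_add_distrib, hc w]
      rw [Finset.sum_eq_single_of_mem e he (fun e' _ hne => by simp [hne])]
      simp [inc, h]
    · refine ⟨c - Pi.single e 1, fun w => ?_⟩
      simp only [Pi.sub_apply, sub_mul, Finset.sum_sub_distrib, hc w]
      rw [Finset.sum_eq_single_of_mem e he (fun e' _ hne => by simp [hne])]
      simp [inc, h]

theorem sum_inc_mul (s : Fin nV → ℝ) (e : Fin nE) :
    ∑ v, (G.inc e v : ℝ) * s v = s (G.ends e).1 - s (G.ends e).2 := by
  simp [inc, sub_mul, Finset.sum_sub_distrib]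

/-- Summing over the complement of `R` when the function vanishes on `R`. -/
theorem sum_subtype_notMem {M : Type*} [AddCommMonoid M] (R : Finset (Fin nV)) (f : Fin nV → M)
    (hf : ∀ v ∈ R, f v = 0) : ∑ v : {v // v ∉ R}, f v = ∑ v, f v := by
  rw [← Finset.sum_subtype (Finset.univ.filter (· ∉ R)) (by simp) f]
  refine Finset.sum_subset (Finset.filter_subset _ _) fun v _ hv => hf v ?_
  simpa using hv

/-- The principal minor of the weighted Laplacian obtained by deleting the vertices in `R`. -/
def lapMinor (R : Finset (Fin nV)) (α : Fin nE → ℝ) : Matrix {v // v ∉ R} {v // v ∉ R} ℝ :=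
  Matrix.of fun v w => ∑ e, α e * ((G.inc e v : ℝ) * G.inc e w)

theorem det_edge_gram (R : Finset (Fin nV)) (F : Finset (Fin nE))
    (hF : F.card = Fintype.card {v // v ∉ R}) :
    (Matrix.of fun v w : {v // v ∉ R} => ∑ e ∈ F, (G.inc e v : ℝ) * G.inc e w).det =
      if ∀ v, ∃ r ∈ R, (G.edgeGraph F).Reachable v r then 1 else 0 := by
  split_ifs with h
  · have e : {v // v ∉ R} ≃ F := Fintype.equivOfCardEq (by simp [hF])
    set B : Matrix {v // v ∉ R} {v // v ∉ R} ℤ := Matrix.of fun n w => G.inc (e n) w with hB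
    have hsum : ∀ f : Fin nE → ℤ, ∑ x ∈ F, f x = ∑ n, f (e n) := fun f => by
      rw [← Finset.sum_coe_sort F f, Equiv.sum_comp e (fun x => f x)]
    have hgram : (Matrix.of fun v w : {v // v ∉ R} => ∑ e ∈ F, (G.inc e v : ℝ) * G.inc e w) =
        (B.transpose * B).map (Int.castRingHom ℝ) := by
      ext v w
      simp only [Matrix.of_apply, Matrix.map_apply, Matrix.mul_apply, Matrix.transpose_apply, hB,
        eq_intCast]
      rw [← hsum fun x => G.inc x v * G.inc x w]
      push_cast
      rfl
    have hex : ∀ v : {v // v ∉ R}, ∃ c : Fin nE → ℤ, ∀ w : {v // v ∉ R},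
        ∑ e ∈ F, c e * G.inc e w = if v = w then 1 else 0 := by
      intro v
      obtain ⟨r, hr, hvr⟩ := h v
      obtain ⟨c, hc⟩ := G.exists_inc_combination hvr
      refine ⟨c, fun w => ?_⟩
      have : r ≠ w := fun h => w.2 (h ▸ hr)
      simp [hc, this, Subtype.ext_iff]
    choose c hc using hex
    have hCB : (Matrix.of fun v n : {v // v ∉ R} => c v (e n)) * B = 1 := by
      ext v w
      simp only [Matrix.mul_apply, Matrix.of_apply, hB, Matrix.one_apply]
      rw [← hsum fun x => c v x * G.inc x w, hc]
    have hunit : IsUnit B.det := Matrix.isUnit_det_of_left_inverse hCB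
    rw [hgram, ← RingHom.mapMatrix_apply, ← RingHom.map_det, Matrix.det_mul,
      Matrix.det_transpose]
    rcases Int.isUnit_iff.1 hunit with h | h <;> simp [h]
  · push Not at h
    obtain ⟨v₀, hv₀⟩ := h
    have hv₀R : v₀ ∉ R := fun hR => hv₀ v₀ hR (SimpleGraph.Reachable.refl _)
    apply Matrix.exists_mulVec_eq_zero_iff.1
    set s : Fin nV → ℝ := fun v => if (G.edgeGraph F).Reachable v₀ v then 1 else 0 with hs
    refine ⟨fun v => s v, ?_, ?_⟩
    · intro h0
      have := congrFun h0 ⟨v₀, hv₀R⟩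
      simp [hs] at this
    · funext v
      simp only [Matrix.mulVec, dotProduct, Matrix.of_apply, Pi.zero_apply, Finset.sum_mul]
      rw [Finset.sum_comm]
      refine Finset.sum_eq_zero fun e he => ?_
      simp only [mul_assoc, ← Finset.mul_sum]
      rw [sum_subtype_notMem R (fun w => (G.inc e w : ℝ) * s w), sum_inc_mul]
      · have hadj := (G.edgeGraph_adj he).reachable
        have : (G.edgeGraph F).Reachable v₀ (G.ends e).1 ↔
            (G.edgeGraph F).Reachable v₀ (G.ends e).2 :=
          ⟨fun h => h.trans hadj, fun h => h.trans hadj.symm⟩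
        simp [hs, this]
      · intro r hr
        simp [hs, hv₀ r hr]

/-- The principal-minors matrix-tree theorem. -/
theorem det_lapMinor (R : Finset (Fin nV)) (α : Fin nE → ℝ) :
    (G.lapMinor R α).det =
      ∑ F with F.card + R.card = nV ∧ ∀ v, ∃ r ∈ R, (G.edgeGraph F).Reachable v r,
        ∏ e ∈ F, α e := by
  have hcard : Fintype.card {v // v ∉ R} + R.card = nV := by
    rw [Fintype.card_subtype_compl, Fintype.card_fin, Fintype.card_coe]
    have := Finset.card_le_univ R
    rw [Fintype.card_fin] at this
    omega
  rw [lapMinor, det_weighted_gram (fun e (v : {v // v ∉ R}) => (G.inc e v : ℝ)),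
    Finset.sum_congr rfl fun F hF => by
      rw [G.det_edge_gram R F (Finset.mem_powersetCard.1 hF).2, mul_ite, mul_one, mul_zero],
    ← Finset.sum_filter]
  congr 1
  ext F
  simp only [Finset.mem_filter, Finset.mem_powersetCard, Finset.subset_univ, true_and,
    Finset.mem_univ]
  refine and_congr_left fun _ => ?_
  omega

theorem not_reachable_of_card {F : Finset (Fin nE)} {j k : Fin nV} (hF : F.card + 2 = nV)
    (h : ∀ v, (G.edgeGraph F).Reachable v j ∨ (G.edgeGraph F).Reachable v k) :
    ¬ (G.edgeGraph F).Reachable j k := by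
  intro hjk
  have hj : ∀ v, (G.edgeGraph F).Reachable v j := fun v =>
    (h v).elim id fun h => h.trans hjk.symm
  have hconn : (G.edgeGraph F).Connected :=
    { preconnected := fun u v => (hj u).trans (hj v).symm
      nonempty := ⟨j⟩ }
  have h1 := hconn.card_vert_le_card_edgeSet_add_one
  have h2 : Nat.card (G.edgeGraph F).edgeSet ≤ F.card := by
    have : (G.edgeGraph F).edgeSet ⊆
        ((F.image fun e => s((G.ends e).1, (G.ends e).2) : Finset (Sym2 (Fin nV))) :
          Set (Sym2 (Fin nV))) := by
      intro x
      induction x with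
      | _ u v =>
        intro hx
        obtain ⟨e, he, h | h⟩ := G.exists_edge_of_adj hx
        · simp only [Finset.coe_image, Set.mem_image]
          exact ⟨e, he, by simp [h]⟩
        · simp only [Finset.coe_image, Set.mem_image]
          exact ⟨e, he, by simp [h, Sym2.eq_swap]⟩
    calc Nat.card (G.edgeGraph F).edgeSet
        ≤ Nat.card ((F.image fun e => s((G.ends e).1, (G.ends e).2) : Finset (Sym2 (Fin nV))) :
          Set (Sym2 (Fin nV))) := Nat.card_mono (Finset.finite_toSet _) this
      _ ≤ F.card := by
        rw [Nat.card_coe_set_eq, Set.ncard_coe_finset]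
        exact Finset.card_image_le
  rw [Nat.card_eq_fintype_card, Fintype.card_fin] at h1
  omega

theorem pairPart_eq {i j k : Fin nV} (hik : i ≠ k) (hjk : j ≠ k)
    (hext : G.ext = {i, j, k}) : G.pairPart i j = {{i, j}, {k}} := by
  have : (G.ext.erase i).erase j = {k} := by
    ext v
    simp only [hext, Finset.mem_erase, Finset.mem_insert, Finset.mem_singleton]
    constructor
    · tauto
    · rintro rfl
      exact ⟨hjk.symm, hik.symm, by simp⟩
  rw [pairPart, this, Finset.image_singleton]

theorem pairPart_comm (i j : Fin nV) : G.pairPart i j = G.pairPart j i := by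
  rw [pairPart, pairPart, Finset.pair_comm, Finset.erase_right_comm]

theorem card_pairPart {i j k : Fin nV} (hik : i ≠ k) (hjk : j ≠ k)
    (hext : G.ext = {i, j, k}) : (G.pairPart i j).card = 2 := by
  rw [G.pairPart_eq hik hjk hext, Finset.card_pair]
  intro h
  have : i ∈ ({k} : Finset (Fin nV)) := h ▸ (by simp)
  exact hik (by simpa using this)

theorem isForest_pairPart {i j k : Fin nV} (hik : i ≠ k) (hjk : j ≠ k)
    (hext : G.ext = {i, j, k}) (F : Finset (Fin nE)) :
    G.IsForest (G.pairPart i j) F ↔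
      (F.card + 2 = nV ∧
        ∀ v, (G.edgeGraph F).Reachable v j ∨ (G.edgeGraph F).Reachable v k) ∧
      (G.edgeGraph F).Reachable i j := by
  have hne : ({i, j} : Finset (Fin nV)) ≠ {k} := by
    intro h
    have : i ∈ ({k} : Finset (Fin nV)) := h ▸ (by simp)
    exact hik (by simpa using this)
  rw [IsForest, G.card_pairPart hik hjk hext, G.pairPart_eq hik hjk hext]
  constructor
  · rintro ⟨h1, h2, h3, h4⟩
    have hij' : (G.edgeGraph F).Reachable i j := h3 {i, j} (by simp) i (by simp) j (by simp)
    have hjk' : ¬ (G.edgeGraph F).Reachable j k :=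
      h4 {i, j} (by simp) {k} (by simp) hne j (by simp) k (by simp)
    refine ⟨⟨h1, fun v => ?_⟩, hij'⟩
    rw [Nat.card_eq_two_iff' ((G.edgeGraph F).connectedComponentMk j)] at h2
    obtain ⟨c, -, hc⟩ := h2
    by_contra! hv
    have e1 := hc ((G.edgeGraph F).connectedComponentMk v)
      (fun h => hv.1 (SimpleGraph.ConnectedComponent.eq.1 h))
    have e2 := hc ((G.edgeGraph F).connectedComponentMk k)
      (fun h => hjk' (SimpleGraph.ConnectedComponent.eq.1 h).symm)
    exact hv.2 (SimpleGraph.ConnectedComponent.eq.1 (e1.trans e2.symm))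
  · rintro ⟨⟨h1, h2⟩, h3⟩
    have hjk' := G.not_reachable_of_card h1 h2
    have hik' : ¬ (G.edgeGraph F).Reachable i k := fun h => hjk' (h3.symm.trans h)
    refine ⟨h1, ?_, ?_, ?_⟩
    · rw [Nat.card_eq_two_iff' ((G.edgeGraph F).connectedComponentMk j)]
      refine ⟨(G.edgeGraph F).connectedComponentMk k,
        fun h => hjk' (SimpleGraph.ConnectedComponent.eq.1 h).symm, fun c => ?_⟩
      induction c using SimpleGraph.ConnectedComponent.ind with
      | _ v =>
        intro hv
        rcases h2 v with h | h
        · exact absurd (SimpleGraph.ConnectedComponent.eq.2 h) hv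
        · exact SimpleGraph.ConnectedComponent.eq.2 h
    · simp [h3, h3.symm]
    · have := fun h => hjk' (SimpleGraph.Reachable.symm h)
      have := fun h => hik' (SimpleGraph.Reachable.symm h)
      intro P hP Q hQ hPQ
      simp only [Finset.mem_insert, Finset.mem_singleton] at hP hQ
      rcases hP with rfl | rfl <;> rcases hQ with rfl | rfl <;> simp_all

theorem det_lapMinor_pair {i j k : Fin nV} (hij : i ≠ j) (hik : i ≠ k) (hjk : j ≠ k)
    (hext : G.ext = {i, j, k}) (α : Fin nE → ℝ) :
    (G.lapMinor {j, k} α).det =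
      G.dualForestPoly (G.pairPart i j) α + G.dualForestPoly (G.pairPart i k) α := by
  have hext' : G.ext = {i, k, j} := by rw [hext, Finset.pair_comm]
  rw [det_lapMinor, dualForestPoly, dualForestPoly, forests, forests, ← Finset.sum_union]
  · congr 1
    ext F
    simp only [Finset.mem_filter, Finset.mem_union, Finset.mem_univ, true_and,
      G.isForest_pairPart hik hjk hext, G.isForest_pairPart hij hjk.symm hext',
      Finset.card_pair hjk, Finset.mem_insert, Finset.mem_singleton, exists_eq_or_imp,
      exists_eq_left, or_comm (a := SimpleGraph.Reachable _ _ k), ← and_or_left]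
    constructor
    · exact fun h => ⟨h, h.2 i⟩
    · exact fun h => h.1
  · rw [Finset.disjoint_left]
    intro F h1 h2
    simp only [Finset.mem_filter, Finset.mem_univ, true_and,
      G.isForest_pairPart hik hjk hext, G.isForest_pairPart hij hjk.symm hext'] at h1 h2
    exact G.not_reachable_of_card h1.1.1 h1.1.2 (h1.2.symm.trans h2.2)

end FeynmanGraph

namespace FeynmanGraph

variable {nV nE : ℕ} (G : FeynmanGraph nV nE)

theorem lapMinor_mulVec (R : Finset (Fin nV)) (α : Fin nE → ℝ) (s : Fin nV → ℝ)
    (hs : ∀ v ∈ R, s v = 0) (v : {v // v ∉ R}) :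
    (G.lapMinor R α).mulVec (fun w => s w) v =
      ∑ e, α e * G.inc e v * (s (G.ends e).1 - s (G.ends e).2) := by
  simp only [Matrix.mulVec, dotProduct, lapMinor, Matrix.of_apply, Finset.sum_mul]
  rw [Finset.sum_comm]
  refine Finset.sum_congr rfl fun e _ => ?_
  rw [← G.sum_inc_mul, ← sum_subtype_notMem R (fun w => (G.inc e w : ℝ) * s w)
    (fun w hw => by simp [hs w hw]), Finset.mul_sum]
  exact Finset.sum_congr rfl fun w _ => by ring

theorem sum_mul_inc_mul (α : Fin nE → ℝ) (s t : Fin nV → ℝ) :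
    ∑ v, t v * ∑ e, α e * G.inc e v * (s (G.ends e).1 - s (G.ends e).2) =
      ∑ e, α e * (t (G.ends e).1 - t (G.ends e).2) * (s (G.ends e).1 - s (G.ends e).2) := by
  simp only [Finset.mul_sum]
  rw [Finset.sum_comm]
  refine Finset.sum_congr rfl fun e _ => ?_
  rw [← G.sum_inc_mul t, Finset.mul_sum, Finset.sum_mul]
  exact Finset.sum_congr rfl fun w _ => by ring

theorem assemble_of_mem {E : Type*} (x : Fin nV → E) (y : {v : Fin nV // v ∉ G.ext} → E)
    {v : Fin nV} (hv : v ∈ G.ext) : G.assemble x y v = x v := by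
  simp [assemble, hv]

theorem assemble_of_notMem {E : Type*} (x : Fin nV → E) (y : {v : Fin nV // v ∉ G.ext} → E)
    {v : Fin nV} (hv : v ∉ G.ext) : G.assemble x y v = y ⟨v, hv⟩ := by
  simp [assemble, hv]

theorem lapMinor_posDef (hconn : ∀ u v : Fin nV, (G.edgeGraph Finset.univ).Reachable u v)
    {R : Finset (Fin nV)} (hR : R.Nonempty) {α : Fin nE → ℝ} (hα : ∀ e, 0 < α e) :
    (G.lapMinor R α).PosDef := by
  apply Matrix.PosDef.of_dotProduct_mulVec_pos
  · ext v w
    simp [lapMinor, mul_comm]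
  · intro y hy
    set s : Fin nV → ℝ := fun v => if h : v ∉ R then y ⟨v, h⟩ else 0 with hs
    have hsR : ∀ v ∈ R, s v = 0 := fun v hv => by simp [hs, hv]
    have hys : y = fun v : {v // v ∉ R} => s v := by
      funext v
      simp [hs, v.2]
    have hform : star y ⬝ᵥ (G.lapMinor R α).mulVec y =
        ∑ e, α e * (s (G.ends e).1 - s (G.ends e).2) * (s (G.ends e).1 - s (G.ends e).2) := by
      rw [← sum_mul_inc_mul, ← sum_subtype_notMem R _ (fun v hv => by rw [hsR v hv, zero_mul]),
        hys]
      simp only [dotProduct, star_trivial]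
      exact Finset.sum_congr rfl fun v _ => by rw [G.lapMinor_mulVec R α s hsR v]
    rw [hform]
    have hnn : ∀ e ∈ Finset.univ, 0 ≤ α e * (s (G.ends e).1 - s (G.ends e).2) *
        (s (G.ends e).1 - s (G.ends e).2) := fun e _ => by
      rw [mul_assoc]
      exact mul_nonneg (hα e).le (mul_self_nonneg _)
    refine lt_of_le_of_ne (Finset.sum_nonneg hnn) fun h0 => hy ?_
    have hedge := (Finset.sum_eq_zero_iff_of_nonneg hnn).1 h0.symm
    have hconst : ∀ u v : Fin nV, s u = s v := by
      intro u v
      obtain ⟨p⟩ := hconn u v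
      induction p with
      | nil => rfl
      | cons hadj _ ih =>
        rw [← ih]
        obtain ⟨e, -, h | h⟩ := G.exists_edge_of_adj hadj
        all_goals
          have := hedge e (Finset.mem_univ e)
          rw [mul_assoc, mul_eq_zero, mul_self_eq_zero] at this
          have := this.resolve_left (hα e).ne'
          rw [h] at this
          simp only at this
          linarith
    obtain ⟨r, hr⟩ := hR
    funext v
    rw [hys]
    exact (hconst v r).trans (hsR r hr)

/-- Existence of harmonic extensions of boundary data. -/
theorem exists_harmonic (hconn : ∀ u v : Fin nV, (G.edgeGraph Finset.univ).Reachable u v)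
    (hne : G.ext.Nonempty) {α : Fin nE → ℝ} (hα : ∀ e, 0 < α e) (t : Fin nV → ℝ) :
    ∃ h : Fin nV → ℝ, (∀ v ∈ G.ext, h v = t v) ∧
      ∀ v ∉ G.ext, ∑ e, α e * G.inc e v * (h (G.ends e).1 - h (G.ends e).2) = 0 := by
  have hdet : IsUnit (G.lapMinor G.ext α).det :=
    (G.lapMinor_posDef hconn hne hα).det_pos.ne'.isUnit
  set g : {v // v ∉ G.ext} → ℝ := (G.lapMinor G.ext α)⁻¹.mulVec
    (fun v => -∑ e, α e * G.inc e v * (t (G.ends e).1 - t (G.ends e).2)) with hg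
  have hLg : (G.lapMinor G.ext α).mulVec g =
      fun v : {v // v ∉ G.ext} => -∑ e, α e * G.inc e v * (t (G.ends e).1 - t (G.ends e).2) := by
    rw [hg, Matrix.mulVec_mulVec, Matrix.mul_nonsing_inv _ hdet, Matrix.one_mulVec]
  refine ⟨t + G.assemble 0 g, fun v hv => by simp [G.assemble_of_mem _ _ hv], fun v hv => ?_⟩
  have h1 := G.lapMinor_mulVec G.ext α (G.assemble 0 g)
    (fun v hv => by simp [G.assemble_of_mem _ _ hv]) ⟨v, hv⟩
  have h2 : (fun w : {v // v ∉ G.ext} => G.assemble 0 g w) = g := by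
    funext w
    rw [G.assemble_of_notMem _ _ w.2]
  rw [h2, hLg] at h1
  simp only at h1
  simp only [Pi.add_apply, add_sub_add_comm, mul_add, Finset.sum_add_distrib, ← h1]
  ring

/-- The Schur complement of the Laplacian with respect to a single boundary vertex. -/
theorem det_mul_energy {i j k : Fin nV} (hij : i ≠ j) (hik : i ≠ k)
    (hext : G.ext = {i, j, k}) {α : Fin nE → ℝ} {h : Fin nV → ℝ}
    (hi : h i = 1) (hj : h j = 0) (hk : h k = 0)
    (hh : ∀ v ∉ G.ext, ∑ e, α e * G.inc e v * (h (G.ends e).1 - h (G.ends e).2) = 0) :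
    (G.lapMinor G.ext α).det *
        ∑ e, α e * (h (G.ends e).1 - h (G.ends e).2) * (h (G.ends e).1 - h (G.ends e).2) =
      (G.lapMinor {j, k} α).det := by
  set C :=
    ∑ e, α e * (h (G.ends e).1 - h (G.ends e).2) * (h (G.ends e).1 - h (G.ends e).2) with hC
  have hCi : ∑ e, α e * G.inc e i * (h (G.ends e).1 - h (G.ends e).2) = C := by
    rw [hC, ← sum_mul_inc_mul, Finset.sum_eq_single i, hi, one_mul]
    · intro v _ hvi
      by_cases hv : v ∈ G.ext
      · rw [hext] at hv
        simp only [Finset.mem_insert, Finset.mem_singleton] at hv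
        rcases hv with rfl | rfl | rfl
        · exact absurd rfl hvi
        · rw [hj, zero_mul]
        · rw [hk, zero_mul]
      · rw [hh v hv, mul_zero]
    · simp
  set A := G.lapMinor {j, k} α with hA
  have hmem : i ∉ ({j, k} : Finset (Fin nV)) := by simp [hij, hik]
  set i' : {v // v ∉ ({j, k} : Finset (Fin nV))} := ⟨i, hmem⟩ with hi'
  have hAh : A.mulVec (fun v => h v) = C • Pi.single i' 1 := by
    funext v
    rw [hA, G.lapMinor_mulVec {j, k} α h (by simp [hj, hk])]
    by_cases hv : v = i'
    · subst hv
      simp [hi', hCi]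
    · have : (v : Fin nV) ≠ i := fun h => hv (Subtype.ext h)
      have hve : (v : Fin nV) ∉ G.ext := by
        have := v.2
        rw [hext]
        simp_all
      simp [hh v hve, hv]
  have hadj : A.adjugate.mulVec (A.mulVec fun v => h v) =
      A.det • fun v : {v // v ∉ ({j, k} : Finset (Fin nV))} => h v := by
    rw [Matrix.mulVec_mulVec, Matrix.adjugate_mul, Matrix.smul_mulVec, Matrix.one_mulVec]
  have h1 := congrFun hadj i'
  rw [hAh, Matrix.mulVec_smul, Matrix.mulVec_single_one] at h1
  simp only [Pi.smul_apply, Matrix.col_apply, smul_eq_mul] at h1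
  have hadjdet : A.adjugate i' i' = (G.lapMinor G.ext α).det := by
    rw [Matrix.adjugate_apply, Matrix.twoBlockTriangular_det _ (fun v => v ≠ i')]
    · let e : {v : {v // v ∉ ({j, k} : Finset (Fin nV))} // v ≠ i'} ≃ {v // v ∉ G.ext} :=
        { toFun := fun v => ⟨v.1.1, by
            have h1 := v.1.2
            have h2 : v.1.1 ≠ i := fun h => v.2 (Subtype.ext h)
            rw [hext]
            simp_all⟩
          invFun := fun v => ⟨⟨v.1, by
            have h1 : ¬ (v : Fin nV) ∈ ({i, j, k} : Finset (Fin nV)) := hext ▸ v.2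
            simp_all⟩, by
            have h1 : ¬ (v : Fin nV) ∈ ({i, j, k} : Finset (Fin nV)) := hext ▸ v.2
            intro h2
            have h3 : v.1 = i := congrArg Subtype.val h2
            exact h1 (by simp [h3])⟩
          left_inv := fun _ => rfl
          right_inv := fun _ => rfl }
      have hsub : Subsingleton {v : {v // v ∉ ({j, k} : Finset (Fin nV))} // ¬ v ≠ i'} :=
        ⟨fun u w => Subtype.ext ((not_not.1 u.2).trans (not_not.1 w.2).symm)⟩
      rw [Matrix.det_eq_elem_of_subsingleton _ (⟨i', by simp⟩ :
        {v : {v // v ∉ ({j, k} : Finset (Fin nV))} // ¬ v ≠ i'}),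
        ← Matrix.det_submatrix_equiv_self e]
      simp only [Matrix.toSquareBlockProp_def, Matrix.of_apply, Matrix.updateRow_self,
        Pi.single_eq_same, mul_one]
      congr 1
      ext v w
      simp only [Matrix.of_apply, Matrix.submatrix_apply]
      rw [Matrix.updateRow_ne v.2]
      rfl
    · intro v hv w hw
      obtain rfl : v = i' := by simpa using hv
      simp [hw]
  rw [hadjdet] at h1
  have : h i' = 1 := hi
  rw [this, mul_one] at h1
  rw [← h1, mul_comm]

/-- Decomposition of the energy of a configuration with three fixed external positions. -/
theorem exists_energy_decomposition {E : Type*} [NormedAddCommGroup E] [InnerProductSpace ℝ E]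
    (hconn : ∀ u v : Fin nV, (G.edgeGraph Finset.univ).Reachable u v)
    {i j k : Fin nV} (hij : i ≠ j) (hik : i ≠ k) (hjk : j ≠ k) (hext : G.ext = {i, j, k})
    {α : Fin nE → ℝ} (hα : ∀ e, 0 < α e) (x : Fin nV → E) :
    ∃ (Q : ℝ) (X : {v // v ∉ G.ext} → E),
      (∀ y : {v // v ∉ G.ext} → E,
        ∑ e, α e * ‖G.assemble x y (G.ends e).1 - G.assemble x y (G.ends e).2‖ ^ 2 =
          Q + ∑ e, α e * ‖G.assemble 0 (y - X) (G.ends e).1 -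
            G.assemble 0 (y - X) (G.ends e).2‖ ^ 2) ∧
      (G.lapMinor G.ext α).det * Q =
        ‖x i - x j‖ ^ 2 * G.dualForestPoly (G.pairPart i j) α +
        ‖x i - x k‖ ^ 2 * G.dualForestPoly (G.pairPart i k) α +
        ‖x j - x k‖ ^ 2 * G.dualForestPoly (G.pairPart j k) α := by
  have hne : G.ext.Nonempty := ⟨i, by simp [hext]⟩
  obtain ⟨f, hf, hfh⟩ := G.exists_harmonic hconn hne hα (Pi.single i 1)
  obtain ⟨g, hg, hgh⟩ := G.exists_harmonic hconn hne hα (Pi.single j 1)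
  have fi : f i = 1 := by rw [hf i (by simp [hext])]; simp
  have fj : f j = 0 := by rw [hf j (by simp [hext])]; simp [hij.symm]
  have fk : f k = 0 := by rw [hf k (by simp [hext])]; simp [hik.symm]
  have gi : g i = 0 := by rw [hg i (by simp [hext])]; simp [hij]
  have gj : g j = 1 := by rw [hg j (by simp [hext])]; simp
  have gk : g k = 0 := by rw [hg k (by simp [hext])]; simp [hjk.symm]
  set df : Fin nE → ℝ := fun e => f (G.ends e).1 - f (G.ends e).2 with hdf
  set dg : Fin nE → ℝ := fun e => g (G.ends e).1 - g (G.ends e).2 with hdg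
  have h1 := G.det_mul_energy hij hik hext fi fj fk hfh
  have h2 := G.det_mul_energy hij.symm hjk (by rw [hext, Finset.insert_comm]) gj gi gk hgh
  have h3 := G.det_mul_energy (α := α) (h := fun v => 1 - f v - g v) hik.symm hjk.symm
    (by rw [hext]; ext v; simp; tauto) (by simp [fk, gk]) (by simp [fi, gi]) (by simp [fj, gj])
    (fun v hv => by
      have e1 := hfh v hv
      have e2 := hgh v hv
      have e3 := congrArg₂ (· + ·) e1 e2
      simp only [← Finset.sum_add_distrib, add_zero] at e3
      rw [← neg_eq_zero, ← Finset.sum_neg_distrib, ← e3]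
      exact Finset.sum_congr rfl fun e _ => by ring)
  rw [G.det_lapMinor_pair hij hik hjk hext] at h1
  rw [G.det_lapMinor_pair hij.symm hjk hik (by rw [hext, Finset.insert_comm]),
    G.pairPart_comm j i] at h2
  rw [G.det_lapMinor_pair hik.symm hjk.symm hij (by rw [hext]; ext v; simp; tauto),
    G.pairPart_comm k i, G.pairPart_comm k j] at h3
  set D := (G.lapMinor G.ext α).det
  set Cff := ∑ e, α e * df e * df e with hCff
  set Cgg := ∑ e, α e * dg e * dg e with hCgg
  set Cfg := ∑ e, α e * df e * dg e with hCfg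
  have h3' : D * (Cff + 2 * Cfg + Cgg) =
      G.dualForestPoly (G.pairPart i k) α + G.dualForestPoly (G.pairPart j k) α := by
    rw [← h3, hCff, hCgg, hCfg, Finset.mul_sum, ← Finset.sum_add_distrib,
      ← Finset.sum_add_distrib]
    congr 1
    exact Finset.sum_congr rfl fun e _ => by simp only [hdf, hdg]; ring
  set a := x i - x k with ha
  set b := x j - x k with hb
  set X : Fin nV → E := fun v => x k + f v • a + g v • b with hX
  have hXext : ∀ v ∈ G.ext, X v = x v := by
    intro v hv
    rw [hext] at hv
    simp only [Finset.mem_insert, Finset.mem_singleton] at hv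
    rcases hv with rfl | rfl | rfl <;> simp [hX, fi, fj, fk, gi, gj, gk, ha, hb]
  have hdX : ∀ e, X (G.ends e).1 - X (G.ends e).2 = df e • a + dg e • b := by
    intro e
    simp only [hX, hdf, hdg]
    module
  refine ⟨∑ e, α e * ‖df e • a + dg e • b‖ ^ 2, fun v => X v, fun y => ?_, ?_⟩
  · set Y := G.assemble 0 (y - fun v : {v // v ∉ G.ext} => X v) with hY
    have hsplit : G.assemble x y = X + Y := by
      funext v
      by_cases hv : v ∈ G.ext
      · simp [hY, G.assemble_of_mem _ _ hv, hXext v hv]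
      · simp [hY, G.assemble_of_notMem _ _ hv]
    have hcross : ∑ e, α e * inner ℝ (df e • a + dg e • b)
        (Y (G.ends e).1 - Y (G.ends e).2) = 0 := by
      have key : ∀ (h : Fin nV → ℝ) (c : E), (∀ v ∉ G.ext,
          ∑ e, α e * G.inc e v * (h (G.ends e).1 - h (G.ends e).2) = 0) →
          ∑ e, α e * ((h (G.ends e).1 - h (G.ends e).2) *
            inner ℝ c (Y (G.ends e).1 - Y (G.ends e).2)) = 0 := by
        intro h c hh
        have := G.sum_mul_inc_mul α h (fun v => inner ℝ c (Y v))
        rw [Finset.sum_eq_zero] at this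
        · rw [this]
          refine Finset.sum_congr rfl fun e _ => ?_
          rw [inner_sub_right]
          ring
        · intro v _
          by_cases hv : v ∈ G.ext
          · simp [hY, G.assemble_of_mem _ _ hv]
          · rw [hh v hv, mul_zero]
      simp only [inner_add_left, real_inner_smul_left, mul_add, Finset.sum_add_distrib]
      rw [key f a hfh, key g b hgh, add_zero]
    rw [hsplit, ← add_zero (∑ e, α e * ‖df e • a + dg e • b‖ ^ 2),
      ← mul_zero 2, ← hcross, Finset.mul_sum, ← Finset.sum_add_distrib,
      ← Finset.sum_add_distrib]
    refine Finset.sum_congr rfl fun e _ => ?_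
    rw [Pi.add_apply, Pi.add_apply, add_sub_add_comm, hdX, norm_add_sq_real]
    ring
  · have hQ : ∑ e, α e * ‖df e • a + dg e • b‖ ^ 2 =
        Cff * ‖a‖ ^ 2 + 2 * Cfg * inner ℝ a b + Cgg * ‖b‖ ^ 2 := by
      rw [hCff, hCgg, hCfg, Finset.sum_mul, Finset.sum_mul, Finset.mul_sum, Finset.sum_mul,
        ← Finset.sum_add_distrib, ← Finset.sum_add_distrib]
      refine Finset.sum_congr rfl fun e _ => ?_
      rw [norm_add_sq_real, norm_smul, norm_smul, real_inner_smul_left, real_inner_smul_right,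
        mul_pow, mul_pow, Real.norm_eq_abs, Real.norm_eq_abs, sq_abs, sq_abs]
      ring
    have hab : ‖x i - x j‖ ^ 2 = ‖a‖ ^ 2 - 2 * inner ℝ a b + ‖b‖ ^ 2 := by
      rw [← norm_sub_sq_real, ha, hb, sub_sub_sub_cancel_right]
    rw [hQ, hab]
    have hfg : D * Cfg = -G.dualForestPoly (G.pairPart i j) α := by linarith
    linear_combination ‖a‖ ^ 2 * h1 + ‖b‖ ^ 2 * h2 + 2 * inner ℝ a b * hfg

end FeynmanGraph

theorem lintegral_ofReal_of_integral_eq {X : Type*} [MeasurableSpace X] {μ : Measure X}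
    {f : X → ℝ} (hf : ∀ x, 0 ≤ f x) {c : ℝ} (hc : ∫ x, f x ∂μ = c) (hc0 : c ≠ 0) :
    ∫⁻ x, ENNReal.ofReal (f x) ∂μ = ENNReal.ofReal c := by
  have hfint : Integrable f μ := Integrable.of_integral_ne_zero (hc ▸ hc0)
  rw [← hc, ofReal_integral_eq_lintegral_ofReal hfint (Filter.Eventually.of_forall hf)]

/-- Schwinger's formula in logarithmic coordinates. -/
theorem integral_exp_mul_sub_exp_mul {a r : ℝ} (ha : 0 < a) (hr : 0 < r) :
    ∫ u : ℝ, Real.exp (a * u - Real.exp u * r) = (1 / r) ^ a * Real.Gamma a := by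
  rw [← Real.integral_rpow_mul_exp_neg_mul_Ioi ha hr, ← Real.range_exp, ← Set.image_univ,
    integral_image_eq_integral_abs_deriv_smul (f' := Real.exp) MeasurableSet.univ
      (fun x _ => (Real.hasDerivAt_exp x).hasDerivWithinAt) Real.exp_injective.injOn,
    setIntegral_univ]
  refine integral_congr_ae (Filter.Eventually.of_forall fun u => ?_)
  simp only [abs_of_pos (Real.exp_pos u), smul_eq_mul]
  rw [← Real.exp_mul, ← mul_assoc, ← Real.exp_add, ← Real.exp_add]
  congr 1
  ring

theorem prod_Gamma_mul_rpow_eq_lintegral {ι : Type*} [Fintype ι] {a ρ : ι → ℝ}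
    (ha : ∀ e, 0 < a e) (hρ : ∀ e, 0 < ρ e) :
    ∫⁻ u : ι → ℝ, ENNReal.ofReal (Real.exp (∑ e, a e * u e - ∑ e, Real.exp (u e) * ρ e ^ 2)) =
      ENNReal.ofReal (∏ e, Real.Gamma (a e)) *
        ENNReal.ofReal (∏ e, ρ e ^ (-(2 * a e))) := by
  have hG : ∀ e, 0 < Real.Gamma (a e) := fun e => Real.Gamma_pos_of_pos (ha e)
  have hR : ∀ e, 0 < ρ e ^ (-(2 * a e)) := fun e => Real.rpow_pos_of_pos (hρ e) _
  rw [← ENNReal.ofReal_mul (Finset.prod_nonneg fun e _ => (hG e).le), ← Finset.prod_mul_distrib]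
  apply lintegral_ofReal_of_integral_eq (fun u => (Real.exp_pos _).le)
  · simp only [← Finset.sum_sub_distrib, Real.exp_sum]
    rw [integral_fintype_prod_volume_eq_prod
      (fun e (u : ℝ) => Real.exp (a e * u - Real.exp u * ρ e ^ 2))]
    refine Finset.prod_congr rfl fun e _ => ?_
    rw [integral_exp_mul_sub_exp_mul (ha e) (pow_pos (hρ e) 2), mul_comm, Real.rpow_neg (hρ e).le,
      Real.rpow_mul (hρ e).le, one_div, Real.inv_rpow (by positivity)]
    norm_num
  · exact (Finset.prod_pos fun e _ => mul_pos (hG e) (hR e)).ne'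

theorem addHaar_setOf_linearMap_eq {V W : Type*} [NormedAddCommGroup V] [NormedSpace ℝ V]
    [MeasurableSpace V] [BorelSpace V] [FiniteDimensional ℝ V] (μ : Measure V)
    [μ.IsAddHaarMeasure] [AddCommGroup W] [Module ℝ W] {l : V →ₗ[ℝ] W} (hl : l ≠ 0) (c : W) :
    μ {y | l y = c} = 0 := by
  rcases Set.eq_empty_or_nonempty {y | l y = c} with h | ⟨y₀, hy₀⟩
  · rw [h, measure_empty]
  · have hset : {y | l y = c} = (AffineSubspace.mk' y₀ (LinearMap.ker l) : Set V) := by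
      ext y
      have : l y₀ = c := hy₀
      simp [AffineSubspace.mem_mk', sub_eq_zero, this]
    rw [hset]
    apply Measure.addHaar_affineSubspace
    intro htop
    apply hl
    have := congrArg AffineSubspace.direction htop
    rwa [AffineSubspace.direction_mk', AffineSubspace.direction_top, LinearMap.ker_eq_top] at this

/-- A matrix acting on tuples of vectors. -/
def matrixAct {N : Type*} [Fintype N] (E : Type*) [AddCommGroup E] [Module ℝ E]
    (B : Matrix N N ℝ) : (N → E) →ₗ[ℝ] (N → E) :=
  LinearMap.pi fun v => ∑ w, B v w • LinearMap.proj w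

theorem matrixAct_apply {N : Type*} [Fintype N] (E : Type*) [AddCommGroup E] [Module ℝ E]
    (B : Matrix N N ℝ) (y : N → E) (v : N) : matrixAct E B y v = ∑ w, B v w • y w := by
  simp [matrixAct]

theorem det_matrixAct {N : Type*} [Fintype N] [DecidableEq N] (d : ℕ) (B : Matrix N N ℝ) :
    LinearMap.det (matrixAct (EuclideanSpace ℝ (Fin d)) B) = B.det ^ d := by
  let b := Pi.basis fun _ : N => (EuclideanSpace.basisFun (Fin d) ℝ).toBasis
  have hmat : LinearMap.toMatrix b b (matrixAct (EuclideanSpace ℝ (Fin d)) B) =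
      (Matrix.kroneckerMap (· * ·) B (1 : Matrix (Fin d) (Fin d) ℝ)).submatrix
        (Equiv.sigmaEquivProd N (Fin d)) (Equiv.sigmaEquivProd N (Fin d)) := by
    ext ⟨v, p⟩ ⟨w, q⟩
    rw [LinearMap.toMatrix_apply, Pi.basis_repr, matrixAct_apply]
    simp only [b, Pi.basis_apply, Matrix.one_apply, Pi.single_apply, smul_ite, smul_zero,
      Finset.sum_ite_eq', Finset.mem_univ, if_true, Matrix.submatrix_apply,
      Matrix.kroneckerMap_apply]
    by_cases hpq : p = q <;> simp [hpq]
  rw [← LinearMap.det_toMatrix b, hmat, Matrix.det_submatrix_equiv_self, Matrix.det_kronecker]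
  simp

theorem lintegral_gaussian_pi (N : Type*) [Fintype N] (d : ℕ) :
    ∫⁻ y : N → EuclideanSpace ℝ (Fin d), ENNReal.ofReal (Real.exp (-∑ v, ‖y v‖ ^ 2)) =
      ENNReal.ofReal (Real.pi ^ ((d : ℝ) / 2 * Fintype.card N)) := by
  apply lintegral_ofReal_of_integral_eq (fun _ => (Real.exp_pos _).le)
  · simp only [← Finset.sum_neg_distrib, Real.exp_sum]
    rw [integral_fintype_prod_volume_eq_pow
      (fun y : EuclideanSpace ℝ (Fin d) => Real.exp (-‖y‖ ^ 2))]
    have := GaussianFourier.integral_rexp_neg_mul_sq_norm (V := EuclideanSpace ℝ (Fin d)) one_pos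
    simp only [neg_mul, one_mul, div_one, finrank_euclideanSpace, Fintype.card_fin] at this
    rw [this, ← Real.rpow_mul_natCast Real.pi_pos.le]
  · exact (Real.rpow_pos_of_pos Real.pi_pos _).ne'

open scoped MatrixOrder in
theorem exists_transpose_mul_self {N : Type*} [Fintype N] [DecidableEq N] {L : Matrix N N ℝ}
    (hL : L.PosDef) : ∃ B : Matrix N N ℝ, L = B.transpose * B := by
  obtain ⟨B, -, hB⟩ := CStarAlgebra.isStrictlyPositive_iff_eq_star_mul_self.mp
    hL.isStrictlyPositive
  exact ⟨B, by rw [hB, Matrix.star_eq_conjTranspose, Matrix.conjTranspose_eq_transpose_of_trivial]⟩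

/-- The Gaussian integral of a positive definite form acting on tuples of vectors. -/
theorem lintegral_gaussian_posDef {N : Type*} [Fintype N] [DecidableEq N] (d : ℕ)
    {L : Matrix N N ℝ} (hL : L.PosDef) :
    ∫⁻ y : N → EuclideanSpace ℝ (Fin d),
        ENNReal.ofReal (Real.exp (-∑ v, ∑ w, L v w * inner ℝ (y v) (y w))) =
      ENNReal.ofReal (L.det ^ (-((d : ℝ) / 2)) * Real.pi ^ ((d : ℝ) / 2 * Fintype.card N)) := by
  obtain ⟨B, hB⟩ := exists_transpose_mul_self hL
  have hdet : L.det = B.det ^ 2 := by rw [hB, Matrix.det_mul, Matrix.det_transpose, sq]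
  have hB0 : B.det ≠ 0 := fun h => hL.det_pos.ne' (by rw [hdet, h]; simp)
  set T := matrixAct (EuclideanSpace ℝ (Fin d)) B with hT
  have hTdet : LinearMap.det T ≠ 0 := by
    rw [hT, det_matrixAct]
    exact pow_ne_zero _ hB0
  have hform : ∀ y : N → EuclideanSpace ℝ (Fin d),
      ∑ v, ∑ w, L v w * inner ℝ (y v) (y w) = ∑ n, ‖T y n‖ ^ 2 := by
    intro y
    simp only [← real_inner_self_eq_norm_sq, hT, matrixAct_apply, sum_inner, inner_sum,
      real_inner_smul_left, real_inner_smul_right, hB, Matrix.mul_apply, Matrix.transpose_apply,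
      Finset.sum_mul]
    rw [Finset.sum_congr rfl fun v _ => Finset.sum_comm, Finset.sum_comm]
    refine Finset.sum_congr rfl fun n _ => Finset.sum_congr rfl fun v _ =>
      Finset.sum_congr rfl fun w _ => ?_
    rw [real_inner_comm]
    ring
  have hmeas : Measurable fun y : N → EuclideanSpace ℝ (Fin d) =>
      ENNReal.ofReal (Real.exp (-∑ v, ‖y v‖ ^ 2)) := by fun_prop
  have hTm : Measurable T := T.continuous_of_finiteDimensional.measurable
  simp only [hform]
  rw [← lintegral_map hmeas hTm, Measure.map_linearMap_addHaar_eq_smul_addHaar _ hTdet,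
    lintegral_smul_measure, lintegral_gaussian_pi, smul_eq_mul, ← ENNReal.ofReal_mul (abs_nonneg _)]
  congr 2
  rw [hT, det_matrixAct, hdet, Real.rpow_neg (sq_nonneg _), abs_inv, abs_pow, ← sq_abs B.det,
    ← Real.rpow_natCast |B.det| 2, ← Real.rpow_mul (abs_nonneg _), ← Real.rpow_natCast |B.det| d]
  congr 2
  push_cast
  ring

/-- Two cut-offs of a scale invariant integrand give the same integral. -/
theorem lintegral_scale_invariant {ι : Type*} [Fintype ι] {F : (ι → ℝ) → ℝ≥0∞}
    {h₁ h₂ : (ι → ℝ) → ℝ} {ψ : ℝ → ℝ≥0∞} (hF : Measurable F) (hh₁ : Measurable h₁)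
    (hh₂ : Measurable h₂) (hψ : Measurable ψ) (hpos₁ : ∀ u, 0 < h₁ u) (hpos₂ : ∀ u, 0 < h₂ u)
    (hFs : ∀ u (s : ℝ), F (u + fun _ => s) = F u)
    (hs₁ : ∀ u (s : ℝ), h₁ (u + fun _ => s) = Real.exp s * h₁ u)
    (hs₂ : ∀ u (s : ℝ), h₂ (u + fun _ => s) = Real.exp (-s) * h₂ u)
    (hC0 : ∫⁻ s, ψ (Real.exp s) ≠ 0) (hCtop : ∫⁻ s, ψ (Real.exp s) ≠ ∞) :
    ∫⁻ u, F u * ψ (h₁ u) = ∫⁻ u, F u * ψ (h₂ u) := by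
  set C := ∫⁻ s, ψ (Real.exp s) with hC
  have hconst : ∀ r : ℝ, 0 < r → ∫⁻ s, ψ (Real.exp s * r) = C := by
    intro r hr
    rw [hC, ← lintegral_add_right_eq_self (fun s => ψ (Real.exp s)) (Real.log r)]
    simp only [Real.exp_add, Real.exp_log hr]
  have key : (∫⁻ u, F u * ψ (h₁ u)) * C = (∫⁻ u, F u * ψ (h₂ u)) * C := by
    calc (∫⁻ u, F u * ψ (h₁ u)) * C
        = ∫⁻ u, ∫⁻ s, F u * ψ (h₁ u) * ψ (Real.exp s * h₂ u) := by
          rw [← lintegral_mul_const' _ _ hCtop]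
          refine lintegral_congr fun u => ?_
          rw [lintegral_const_mul _ (by fun_prop), hconst _ (hpos₂ u)]
      _ = ∫⁻ s, ∫⁻ u, F u * ψ (h₁ u) * ψ (Real.exp s * h₂ u) :=
          lintegral_lintegral_swap (by fun_prop)
      _ = ∫⁻ s, ∫⁻ u, F u * ψ (h₂ u) * ψ (Real.exp s * h₁ u) := by
          refine lintegral_congr fun s => ?_
          rw [← lintegral_add_right_eq_self _ (fun _ : ι => s)]
          refine lintegral_congr fun u => ?_
          rw [hFs, hs₁, hs₂, ← mul_assoc (Real.exp s), ← Real.exp_add, add_neg_cancel,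
            Real.exp_zero, one_mul, mul_right_comm]
      _ = ∫⁻ u, ∫⁻ s, F u * ψ (h₂ u) * ψ (Real.exp s * h₁ u) :=
          lintegral_lintegral_swap (by fun_prop)
      _ = (∫⁻ u, F u * ψ (h₂ u)) * C := by
          rw [← lintegral_mul_const' _ _ hCtop]
          refine lintegral_congr fun u => ?_
          rw [lintegral_const_mul _ (by fun_prop), hconst _ (hpos₁ u)]
  exact (ENNReal.mul_left_inj hC0 hCtop).1 key

theorem lintegral_comp_neg_equiv {ι ι' : Type*} [Fintype ι] [Fintype ι'] (φ : ι ≃ ι')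
    (f : (ι' → ℝ) → ℝ≥0∞) : ∫⁻ u, f u = ∫⁻ v : ι → ℝ, f fun e => -v (φ.symm e) := by
  rw [← lintegral_neg_eq_self, ← (volume_measurePreserving_piCongrLeft (fun _ : ι' => ℝ)
    φ).lintegral_comp_emb (MeasurableEquiv.measurableEmbedding _)]
  refine lintegral_congr fun v => congrArg f (funext fun e => ?_)
  rw [Pi.neg_apply, MeasurableEquiv.coe_piCongrLeft]
  obtain ⟨e, rfl⟩ := φ.surjective e
  rw [Equiv.piCongrLeft_apply_apply, Equiv.symm_apply_apply]

namespace FeynmanGraph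

variable {nV nE : ℕ} (G : FeynmanGraph nV nE)

theorem card_subtype_notMem_ext : Fintype.card {v // v ∉ G.ext} = G.intVerts.card := by
  rw [intVerts, Fintype.card_subtype]

theorem card_intVerts_add_three {i j k : Fin nV} (hij : i ≠ j) (hik : i ≠ k) (hjk : j ≠ k)
    (hext : G.ext = {i, j, k}) : G.intVerts.card + 3 = nV := by
  have h3 : G.ext.card = 3 := by
    rw [hext, Finset.card_eq_three]
    exact ⟨i, j, k, hij, hik, hjk, rfl⟩
  have h : G.intVerts = G.extᶜ := by ext v; simp [intVerts]
  have := Finset.card_add_card_compl G.ext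
  rw [Fintype.card_fin] at this
  rw [h]
  omega

theorem sum_mul_norm_sq_eq_lapMinor {E : Type*} [NormedAddCommGroup E] [InnerProductSpace ℝ E]
    (α : Fin nE → ℝ) (y : {v // v ∉ G.ext} → E) :
    ∑ e, α e * ‖G.assemble 0 y (G.ends e).1 - G.assemble 0 y (G.ends e).2‖ ^ 2 =
      ∑ v, ∑ w, G.lapMinor G.ext α v w * inner ℝ (y v) (y w) := by
  have hdiff : ∀ e, G.assemble 0 y (G.ends e).1 - G.assemble 0 y (G.ends e).2 =
      ∑ v : {v // v ∉ G.ext}, (G.inc e v : ℝ) • y v := by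
    intro e
    have h1 : ∑ v : {v // v ∉ G.ext}, (G.inc e v : ℝ) • y v =
        ∑ v : {v // v ∉ G.ext}, (G.inc e v : ℝ) • G.assemble 0 y v :=
      Finset.sum_congr rfl fun v _ => by rw [G.assemble_of_notMem _ _ v.2]
    rw [h1, sum_subtype_notMem G.ext (fun v => (G.inc e v : ℝ) • G.assemble 0 y v)
      (fun v hv => by simp [G.assemble_of_mem _ _ hv])]
    simp [inc, sub_smul, Finset.sum_sub_distrib]
  simp only [hdiff, ← real_inner_self_eq_norm_sq, sum_inner, inner_sum, real_inner_smul_left,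
    real_inner_smul_right, lapMinor, Matrix.of_apply, Finset.mul_sum, Finset.sum_mul]
  rw [Finset.sum_comm]
  refine Finset.sum_congr rfl fun v _ => ?_
  rw [Finset.sum_comm]
  refine Finset.sum_congr rfl fun w _ => Finset.sum_congr rfl fun e _ => ?_
  rw [real_inner_comm]
  ring

/-- The combination `a Ψ̃^{p(i,j)} + b Ψ̃^{p(i,k)} + c Ψ̃^{p(j,k)}`. -/
def pairForm (i j k : Fin nV) (a b c : ℝ) (α : Fin nE → ℝ) : ℝ :=
  a * G.dualForestPoly (G.pairPart i j) α + b * G.dualForestPoly (G.pairPart i k) α +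
    c * G.dualForestPoly (G.pairPart j k) α

theorem dualForestPoly_nonneg (p : Finset (Finset (Fin nV))) {α : Fin nE → ℝ}
    (hα : ∀ e, 0 < α e) : 0 ≤ G.dualForestPoly p α :=
  Finset.sum_nonneg fun _ _ => Finset.prod_nonneg fun e _ => (hα e).le

theorem pairForm_pos (hconn : ∀ u v : Fin nV, (G.edgeGraph Finset.univ).Reachable u v)
    {i j k : Fin nV} (hij : i ≠ j) (hik : i ≠ k) (hjk : j ≠ k) (hext : G.ext = {i, j, k})
    {a b c : ℝ} (ha : 0 < a) (hb : 0 < b) (hc : 0 < c) {α : Fin nE → ℝ} (hα : ∀ e, 0 < α e) :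
    0 < G.pairForm i j k a b c α := by
  have hsum := (G.lapMinor_posDef hconn (R := {j, k}) ⟨j, by simp⟩ hα).det_pos
  rw [G.det_lapMinor_pair hij hik hjk hext] at hsum
  have h1 := G.dualForestPoly_nonneg (G.pairPart i j) hα
  have h2 := G.dualForestPoly_nonneg (G.pairPart i k) hα
  have h3 := G.dualForestPoly_nonneg (G.pairPart j k) hα
  rw [pairForm]
  rcases h1.lt_or_eq with h | h
  · positivity
  · rw [← h, zero_add] at hsum
    positivity

theorem lapMinor_smul (R : Finset (Fin nV)) (t : ℝ) (α : Fin nE → ℝ) :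
    G.lapMinor R (fun e => t * α e) = t • G.lapMinor R α := by
  ext v w
  simp [lapMinor, Finset.mul_sum, mul_assoc]

theorem det_lapMinor_smul (t : ℝ) (α : Fin nE → ℝ) :
    (G.lapMinor G.ext fun e => t * α e).det =
      t ^ G.intVerts.card * (G.lapMinor G.ext α).det := by
  rw [lapMinor_smul, Matrix.det_smul, card_subtype_notMem_ext]

theorem dualForestPoly_smul {p : Finset (Finset (Fin nV))} {n : ℕ} (hp : n + p.card = nV)
    (t : ℝ) (α : Fin nE → ℝ) :
    G.dualForestPoly p (fun e => t * α e) = t ^ n * G.dualForestPoly p α := by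
  rw [dualForestPoly, dualForestPoly, Finset.mul_sum]
  refine Finset.sum_congr rfl fun F hF => ?_
  have hcard : F.card + p.card = nV := (Finset.mem_filter.1 hF).2.1
  rw [Finset.prod_mul_distrib, Finset.prod_const, Nat.add_right_cancel (hcard.trans hp.symm)]

theorem pairForm_smul {i j k : Fin nV} (hij : i ≠ j) (hik : i ≠ k) (hjk : j ≠ k)
    (hext : G.ext = {i, j, k}) (a b c t : ℝ) (α : Fin nE → ℝ) :
    G.pairForm i j k a b c (fun e => t * α e) =
      t ^ (G.intVerts.card + 1) * G.pairForm i j k a b c α := by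
  have hn := G.card_intVerts_add_three hij hik hjk hext
  have hext' : G.ext = {i, k, j} := by rw [hext, Finset.pair_comm]
  have hext'' : G.ext = {j, k, i} := by
    rw [hext]
    ext v
    simp only [Finset.mem_insert, Finset.mem_singleton]
    tauto
  have h1 := G.card_pairPart hik hjk hext
  have h2 := G.card_pairPart hij hjk.symm hext'
  have h3 := G.card_pairPart hij.symm hik.symm hext''
  rw [pairForm, pairForm, G.dualForestPoly_smul (n := G.intVerts.card + 1) (by omega),
    G.dualForestPoly_smul (n := G.intVerts.card + 1) (by omega),
    G.dualForestPoly_smul (n := G.intVerts.card + 1) (by omega)]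
  ring

theorem continuous_dualForestPoly (p : Finset (Finset (Fin nV))) :
    Continuous (G.dualForestPoly p) := by
  unfold dualForestPoly
  fun_prop

theorem continuous_pairForm (i j k : Fin nV) (a b c : ℝ) :
    Continuous (G.pairForm i j k a b c) := by
  have := G.continuous_dualForestPoly
  unfold pairForm
  fun_prop

theorem continuous_det_lapMinor (R : Finset (Fin nV)) :
    Continuous fun α => (G.lapMinor R α).det := by
  refine Continuous.matrix_det ?_
  unfold lapMinor
  fun_prop

/-- The forest polynomial is the reciprocal of the dual forest polynomial. -/
theorem forestPoly_eq (p : Finset (Finset (Fin nV))) {α : Fin nE → ℝ} (hα : ∀ e, α e ≠ 0) :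
    G.forestPoly p α = (∏ e, α e) * G.dualForestPoly p fun e => (α e)⁻¹ := by
  rw [forestPoly, dualForestPoly, Finset.mul_sum]
  refine Finset.sum_congr rfl fun F _ => ?_
  rw [Finset.prod_inv_distrib, eq_mul_inv_iff_mul_eq₀ (Finset.prod_ne_zero_iff.2 fun e _ => hα e),
    Finset.prod_sdiff (Finset.subset_univ F)]

theorem continuous_assemble {E : Type*} [TopologicalSpace E] (x : Fin nV → E) (v : Fin nV) :
    Continuous fun y => G.assemble x y v := by
  by_cases hv : v ∈ G.ext
  · simp only [G.assemble_of_mem x _ hv]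
    fun_prop
  · simp only [G.assemble_of_notMem x _ hv]
    fun_prop

/-- For almost all positions of the internal vertices no edge has length zero. -/
theorem ae_assemble_ne {d : ℕ} (hd : 0 < d) {x : Fin nV → EuclideanSpace ℝ (Fin d)}
    (hx : Set.InjOn x G.ext) :
    ∀ᵐ y : {v // v ∉ G.ext} → EuclideanSpace ℝ (Fin d), ∀ e,
      0 < ‖G.assemble x y (G.ends e).1 - G.assemble x y (G.ends e).2‖ := by
  have : Nonempty (Fin d) := ⟨⟨0, hd⟩⟩
  rw [ae_all_iff]
  intro e
  simp only [norm_pos_iff, sub_ne_zero]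
  have hne := G.ends_ne e
  generalize (G.ends e).1 = u at hne
  generalize (G.ends e).2 = w at hne
  obtain ⟨b, hb⟩ := exists_ne (0 : EuclideanSpace ℝ (Fin d))
  by_cases hu : u ∈ G.ext
  · by_cases hw : w ∈ G.ext
    · refine Filter.Eventually.of_forall fun y => ?_
      rw [G.assemble_of_mem _ _ hu, G.assemble_of_mem _ _ hw]
      exact fun h => hne (hx hu hw h)
    · have hl : (LinearMap.proj ⟨w, hw⟩ : ({v // v ∉ G.ext} → EuclideanSpace ℝ (Fin d)) →ₗ[ℝ]
          EuclideanSpace ℝ (Fin d)) ≠ 0 := fun h =>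
        hb (by simpa using LinearMap.congr_fun h fun _ => b)
      refine measure_mono_null (fun y hy => ?_) (addHaar_setOf_linearMap_eq volume hl (x u))
      simp only [Set.mem_compl_iff, Set.mem_ofPred_eq, not_not, G.assemble_of_mem _ _ hu,
        G.assemble_of_notMem _ _ hw] at hy
      simp [hy]
  · have hl : (LinearMap.proj ⟨u, hu⟩ - (if hw : w ∈ G.ext then 0 else LinearMap.proj ⟨w, hw⟩) :
        ({v // v ∉ G.ext} → EuclideanSpace ℝ (Fin d)) →ₗ[ℝ] EuclideanSpace ℝ (Fin d)) ≠ 0 := by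
      intro h
      have := LinearMap.congr_fun h (Pi.single ⟨u, hu⟩ b)
      apply hb
      by_cases hw : w ∈ G.ext
      · simpa [hw] using this
      · simpa [hw, Pi.single_apply, hne.symm] using this
    refine measure_mono_null (fun y hy => ?_)
      (addHaar_setOf_linearMap_eq volume hl (if w ∈ G.ext then x w else 0))
    simp only [Set.mem_compl_iff, Set.mem_ofPred_eq, not_not, G.assemble_of_notMem _ _ hu] at hy
    by_cases hw : w ∈ G.ext
    · simp [hw, hy, G.assemble_of_mem _ _ hw]
    · simp [hw, hy, G.assemble_of_notMem _ _ hw]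

/-- Integrating out the internal vertices of a Gaussian weight. -/
theorem lintegral_exp_neg_energy {d : ℕ}
    (hconn : ∀ u v : Fin nV, (G.edgeGraph Finset.univ).Reachable u v)
    {i j k : Fin nV} (hij : i ≠ j) (hik : i ≠ k) (hjk : j ≠ k) (hext : G.ext = {i, j, k})
    {α : Fin nE → ℝ} (hα : ∀ e, 0 < α e) (x : Fin nV → EuclideanSpace ℝ (Fin d)) :
    ∫⁻ y, ENNReal.ofReal (Real.exp
        (-∑ e, α e * ‖G.assemble x y (G.ends e).1 - G.assemble x y (G.ends e).2‖ ^ 2)) =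
      ENNReal.ofReal ((G.lapMinor G.ext α).det ^ (-((d : ℝ) / 2)) *
        Real.exp (-(G.pairForm i j k (‖x i - x j‖ ^ 2) (‖x i - x k‖ ^ 2) (‖x j - x k‖ ^ 2) α /
          (G.lapMinor G.ext α).det))) *
      ENNReal.ofReal (Real.pi ^ ((d : ℝ) / 2 * (G.intVerts.card : ℝ))) := by
  have hpd := G.lapMinor_posDef hconn (R := G.ext) ⟨i, by simp [hext]⟩ hα
  have hD := hpd.det_pos
  obtain ⟨Q, X, hQ, hdet⟩ := G.exists_energy_decomposition hconn hij hik hjk hext hα x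
  have hQ' : G.pairForm i j k (‖x i - x j‖ ^ 2) (‖x i - x k‖ ^ 2) (‖x j - x k‖ ^ 2) α /
      (G.lapMinor G.ext α).det = Q := by
    rw [pairForm, ← hdet, mul_div_cancel_left₀ _ hD.ne']
  rw [hQ']
  simp only [hQ, neg_add, Real.exp_add, ENNReal.ofReal_mul (Real.exp_pos _).le]
  rw [lintegral_const_mul' _ _ ENNReal.ofReal_ne_top,
    lintegral_sub_right_eq_self (fun y => ENNReal.ofReal (Real.exp
      (-∑ e, α e * ‖G.assemble 0 y (G.ends e).1 - G.assemble 0 y (G.ends e).2‖ ^ 2))) X]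
  simp only [sum_mul_norm_sq_eq_lapMinor]
  have hr := Real.rpow_nonneg hD.le (-((d : ℝ) / 2))
  rw [lintegral_gaussian_posDef d hpd, card_subtype_notMem_ext, ENNReal.ofReal_mul hr,
    ENNReal.ofReal_mul hr]
  ring

/-- The parametric representation in logarithmic Schwinger parameters. -/
theorem prod_Gamma_mul_posIntegral {d : ℕ} (hd : 0 < d)
    (hconn : ∀ u v : Fin nV, (G.edgeGraph Finset.univ).Reachable u v)
    {i j k : Fin nV} (hij : i ≠ j) (hik : i ≠ k) (hjk : j ≠ k) (hext : G.ext = {i, j, k})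
    (hν : ∀ e, 0 < lam d * G.ν e) {x : Fin nV → EuclideanSpace ℝ (Fin d)}
    (hx : Set.InjOn x G.ext) :
    ENNReal.ofReal (∏ e, Real.Gamma (lam d * G.ν e)) * G.posIntegral d x =
      ∫⁻ u : Fin nE → ℝ, ENNReal.ofReal (Real.exp (∑ e, lam d * G.ν e * u e)) *
        ENNReal.ofReal ((G.lapMinor G.ext fun e => Real.exp (u e)).det ^ (-((d : ℝ) / 2)) *
          Real.exp (-(G.pairForm i j k (‖x i - x j‖ ^ 2) (‖x i - x k‖ ^ 2) (‖x j - x k‖ ^ 2)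
            (fun e => Real.exp (u e)) / (G.lapMinor G.ext fun e => Real.exp (u e)).det))) := by
  have hK : 0 < Real.pi ^ ((d : ℝ) / 2 * (G.intVerts.card : ℝ)) :=
    Real.rpow_pos_of_pos Real.pi_pos _
  rw [posIntegral, ← mul_div_assoc, eq_comm, ENNReal.eq_div_iff
    (ENNReal.ofReal_pos.2 hK).ne' ENNReal.ofReal_ne_top, eq_comm, mul_comm (ENNReal.ofReal (_ ^ _)),
    ← lintegral_const_mul' _ _ ENNReal.ofReal_ne_top,
    ← lintegral_mul_const' _ _ ENNReal.ofReal_ne_top]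
  have hcont := G.continuous_assemble x
  calc _ = ∫⁻ y, ∫⁻ u : Fin nE → ℝ, ENNReal.ofReal (Real.exp (∑ e, lam d * G.ν e * u e -
          ∑ e, Real.exp (u e) *
            ‖G.assemble x y (G.ends e).1 - G.assemble x y (G.ends e).2‖ ^ 2)) := by
        refine lintegral_congr_ae ?_
        filter_upwards [G.ae_assemble_ne hd hx] with y hy
        rw [prod_Gamma_mul_rpow_eq_lintegral hν hy]
        simp only [mul_assoc]
    _ = ∫⁻ u : Fin nE → ℝ, ∫⁻ y, ENNReal.ofReal (Real.exp (∑ e, lam d * G.ν e * u e -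
          ∑ e, Real.exp (u e) *
            ‖G.assemble x y (G.ends e).1 - G.assemble x y (G.ends e).2‖ ^ 2)) := by
        have hcont' : ∀ v, Continuous fun p : ({v // v ∉ G.ext} → EuclideanSpace ℝ (Fin d)) ×
            (Fin nE → ℝ) => G.assemble x p.1 v := fun v => (hcont v).comp continuous_fst
        refine lintegral_lintegral_swap
          (ENNReal.continuous_ofReal.comp (Real.continuous_exp.comp ?_)).aemeasurable
        fun_prop
    _ = _ := by
        refine lintegral_congr fun u => ?_
        rw [mul_assoc, ← G.lintegral_exp_neg_energy hconn hij hik hjk hext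
          (fun e => Real.exp_pos (u e)) x, ← lintegral_const_mul' _ _ ENNReal.ofReal_ne_top]
        simp only [sub_eq_add_neg, Real.exp_add, ENNReal.ofReal_mul (Real.exp_pos _).le]

end FeynmanGraph

theorem ofReal_rpow_neg_mul_exp_neg {D P : ℝ} (hD : 0 < D) (hP : 0 < P) (c : ℝ) :
    ENNReal.ofReal (D ^ (-c) * Real.exp (-(P / D))) =
      ENNReal.ofReal (P ^ (-c)) * ENNReal.ofReal ((P / D) ^ c * Real.exp (-(P / D))) := by
  rw [← ENNReal.ofReal_mul (Real.rpow_nonneg hP.le _), ← mul_assoc, Real.div_rpow hP.le hD.le,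
    Real.rpow_neg hP.le, Real.rpow_neg hD.le, ← mul_div_assoc,
    inv_mul_cancel₀ (Real.rpow_pos_of_pos hP c).ne', one_div]

theorem lintegral_rpow_mul_exp_neg_exp {c : ℝ} (hc : 0 < c) :
    ∫⁻ s, ENNReal.ofReal (Real.exp s ^ c * Real.exp (-Real.exp s)) =
      ENNReal.ofReal (Real.Gamma c) := by
  refine lintegral_ofReal_of_integral_eq (fun s => by positivity) ?_ (Real.Gamma_pos_of_pos hc).ne'
  have h := integral_exp_mul_sub_exp_mul hc one_pos
  simp only [mul_one, div_one, Real.one_rpow, one_mul] at h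
  rw [← h]
  refine integral_congr_ae (Filter.Eventually.of_forall fun s => ?_)
  simp only [← Real.exp_mul, ← Real.exp_add]
  ring_nf

namespace FeynmanGraph

variable {nV nE : ℕ} (G : FeynmanGraph nV nE)

/-- The parametric representation of the Feynman integral, written as a cut-off of a function of
the logarithmic parameters which is scale invariant if `M_G = d/2`. -/
theorem prod_Gamma_mul_posIntegral_eq_cutoff {d : ℕ} (hd : 0 < d)
    (hconn : ∀ u v : Fin nV, (G.edgeGraph Finset.univ).Reachable u v)
    {i j k : Fin nV} (hij : i ≠ j) (hik : i ≠ k) (hjk : j ≠ k) (hext : G.ext = {i, j, k})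
    (hν : ∀ e, 0 < lam d * G.ν e) {x : Fin nV → EuclideanSpace ℝ (Fin d)}
    {a b c : ℝ} (ha : 0 < a) (hb : 0 < b) (hc : 0 < c)
    (hxij : ‖x i - x j‖ ^ 2 = a) (hxik : ‖x i - x k‖ ^ 2 = b) (hxjk : ‖x j - x k‖ ^ 2 = c) :
    ENNReal.ofReal (∏ e, Real.Gamma (lam d * G.ν e)) * G.posIntegral d x =
      ∫⁻ u : Fin nE → ℝ, ENNReal.ofReal (Real.exp (∑ e, lam d * G.ν e * u e) *
          G.pairForm i j k a b c (fun e => Real.exp (u e)) ^ (-((d : ℝ) / 2))) *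
        ENNReal.ofReal ((G.pairForm i j k a b c (fun e => Real.exp (u e)) /
            (G.lapMinor G.ext fun e => Real.exp (u e)).det) ^ ((d : ℝ) / 2) *
          Real.exp (-(G.pairForm i j k a b c (fun e => Real.exp (u e)) /
            (G.lapMinor G.ext fun e => Real.exp (u e)).det))) := by
  have hne : ∀ {v w : Fin nV}, 0 < ‖x v - x w‖ ^ 2 → x v ≠ x w := fun h h' => by simp [h'] at h
  have h1 := hne (hxij ▸ ha)
  have h2 := hne (hxik ▸ hb)
  have h3 := hne (hxjk ▸ hc)
  have hx : Set.InjOn x G.ext := by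
    intro v hv w hw hvw
    simp only [hext, Finset.coe_insert, Finset.coe_singleton, Set.mem_insert_iff,
      Set.mem_singleton_iff] at hv hw
    rcases hv with rfl | rfl | rfl <;> rcases hw with rfl | rfl | rfl <;> simp_all
  rw [G.prod_Gamma_mul_posIntegral hd hconn hij hik hjk hext hν hx, hxij, hxik, hxjk]
  refine lintegral_congr fun u => ?_
  have hα : ∀ e, 0 < Real.exp (u e) := fun e => Real.exp_pos _
  rw [ofReal_rpow_neg_mul_exp_neg
    (G.lapMinor_posDef hconn (R := G.ext) ⟨i, by simp [hext]⟩ hα).det_pos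
    (G.pairForm_pos hconn hij hik hjk hext ha hb hc hα),
    ENNReal.ofReal_mul (Real.exp_pos _).le, mul_assoc]

theorem norm_extPos_sub_sq {d : ℕ} (hd : 2 < d) {i j k : Fin nV} (hij : i ≠ j) (hik : i ≠ k)
    (hjk : j ≠ k) (z : ℂ) :
    ‖extPos d i j k z i - extPos d i j k z j‖ ^ 2 = 1 ∧
      ‖extPos d i j k z i - extPos d i j k z k‖ ^ 2 = Complex.normSq z ∧
      ‖extPos d i j k z j - extPos d i j k z k‖ ^ 2 = Complex.normSq (z - 1) := by
  obtain ⟨n, rfl⟩ := Nat.exists_eq_add_of_lt hd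
  rw [show 2 + n + 1 = n + 1 + 1 + 1 by ring]
  refine ⟨?_, ?_, ?_⟩ <;>
  simp [EuclideanSpace.norm_sq_eq, extPos, hij.symm, hik.symm, hjk.symm, Fin.sum_univ_succ,
    Complex.normSq_apply, sq_abs] <;> ring

end FeynmanGraph

/-- Duality of graphical functions (analytic core).  Let `G`, `G'`
be connected graphs with three external vertices each (`v0, v1, vz` resp.
`w0, w1, wz`), and `φ` a bijection of edge sets with `λν'_{φ(e)} = d/2 - λν_e` and
`0 < λν_e < d/2`.  If both graphs are ultraviolet and infrared convergent with
`M_G = M_{G'} = d/2`, and for each pair of external labels the dual spanning forest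
polynomial of `G` agrees with the spanning forest polynomial of `G'` under `φ`, then
`f_{G'}(z) = f_G(z) · ∏_e Γ(λν_e)/Γ(d/2 - λν_e)` for all `z ∈ ℂ ∖ {0,1}`. -/
theorem duality_graphical_functions {d nV nE nV' nE' : ℕ} (hd : 2 < d)
    (G : FeynmanGraph nV nE) (G' : FeynmanGraph nV' nE')
    (hGconn : ∀ u v : Fin nV, (G.edgeGraph Finset.univ).Reachable u v)
    (hG'conn : ∀ u v : Fin nV', (G'.edgeGraph Finset.univ).Reachable u v)
    (v0 v1 vz : Fin nV) (h01 : v0 ≠ v1) (h0z : v0 ≠ vz) (h1z : v1 ≠ vz)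
    (hext : G.ext = {v0, v1, vz})
    (w0 w1 wz : Fin nV') (h01' : w0 ≠ w1) (h0z' : w0 ≠ wz) (h1z' : w1 ≠ wz)
    (hext' : G'.ext = {w0, w1, wz})
    (φ : Fin nE ≃ Fin nE')
    (hweight : ∀ e, lam d * G'.ν (φ e) = (d : ℝ) / 2 - lam d * G.ν e)
    (hpos : ∀ e, 0 < lam d * G.ν e ∧ lam d * G.ν e < (d : ℝ) / 2)
    (hUV : G.UVConvergent d) (hIR : G.IRConvergent d)
    (hUV' : G'.UVConvergent d) (hIR' : G'.IRConvergent d)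
    (hM : G.Mdeg d = (d : ℝ) / 2) (hM' : G'.Mdeg d = (d : ℝ) / 2)
    (hpoly01 : ∀ α : Fin nE → ℝ,
      G.dualForestPoly (G.pairPart v0 v1) α = G'.forestPoly (G'.pairPart w0 w1) (α ∘ φ.symm))
    (hpoly0z : ∀ α : Fin nE → ℝ,
      G.dualForestPoly (G.pairPart v0 vz) α = G'.forestPoly (G'.pairPart w0 wz) (α ∘ φ.symm))
    (hpoly1z : ∀ α : Fin nE → ℝ,
      G.dualForestPoly (G.pairPart v1 vz) α = G'.forestPoly (G'.pairPart w1 wz) (α ∘ φ.symm))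
    (z : ℂ) (hz0 : z ≠ 0) (hz1 : z ≠ 1) :
    G'.graphicalFn d w0 w1 wz z =
      G.graphicalFn d v0 v1 vz z *
        ENNReal.ofReal
          (∏ e, Real.Gamma (lam d * G.ν e) / Real.Gamma ((d : ℝ) / 2 - lam d * G.ν e)) := by
  set a : Fin nE → ℝ := fun e => lam d * G.ν e with ha
  have hd0 : (0 : ℝ) < (d : ℝ) / 2 := by positivity
  have hν' : ∀ e, 0 < lam d * G'.ν e := fun e => by
    obtain ⟨e, rfl⟩ := φ.surjective e
    rw [hweight]
    linarith [(hpos e).2]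
  have hn0 : 0 < Complex.normSq z := Complex.normSq_pos.2 hz0
  have hn1 : 0 < Complex.normSq (z - 1) := Complex.normSq_pos.2 (sub_ne_zero.2 hz1)
  obtain ⟨hx01, hx0z, hx1z⟩ := FeynmanGraph.norm_extPos_sub_sq hd h01 h0z h1z z
  obtain ⟨hx01', hx0z', hx1z'⟩ := FeynmanGraph.norm_extPos_sub_sq hd h01' h0z' h1z' z
  set Φ := G.pairForm v0 v1 vz 1 (Complex.normSq z) (Complex.normSq (z - 1)) with hΦ
  set Φ' := G'.pairForm w0 w1 wz 1 (Complex.normSq z) (Complex.normSq (z - 1)) with hΦ'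
  have hΦm : Measurable Φ := (G.continuous_pairForm _ _ _ _ _ _).measurable
  have hΦm' : Measurable Φ' := (G'.continuous_pairForm _ _ _ _ _ _).measurable
  have hDm := (G.continuous_det_lapMinor G.ext).measurable
  have hDm' := (G'.continuous_det_lapMinor G'.ext).measurable
  have hΦpos : ∀ u : Fin nE → ℝ, 0 < Φ fun e => Real.exp (u e) := fun u =>
    G.pairForm_pos hGconn h01 h0z h1z hext one_pos hn0 hn1 fun e => Real.exp_pos _
  have hΦpos' : ∀ u : Fin nE' → ℝ, 0 < Φ' fun e => Real.exp (u e) := fun u =>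
    G'.pairForm_pos hG'conn h01' h0z' h1z' hext' one_pos hn0 hn1 fun e => Real.exp_pos _
  have hDpos : ∀ u : Fin nE → ℝ, 0 < (G.lapMinor G.ext fun e => Real.exp (u e)).det := fun u =>
    (G.lapMinor_posDef hGconn (R := G.ext) ⟨v0, by simp [hext]⟩ fun e => Real.exp_pos _).det_pos
  have hDpos' : ∀ u : Fin nE' → ℝ, 0 < (G'.lapMinor G'.ext fun e => Real.exp (u e)).det := fun u =>
    (G'.lapMinor_posDef hG'conn (R := G'.ext) ⟨w0, by simp [hext']⟩
      fun e => Real.exp_pos _).det_pos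
  have hdual : ∀ v : Fin nE → ℝ,
      (Φ' fun e => Real.exp (-v (φ.symm e))) =
        Real.exp (-∑ e, v e) * Φ fun e => Real.exp (v e) := by
    intro v
    have hrec : ∀ p, G'.forestPoly p ((fun e => Real.exp (v e)) ∘ φ.symm) =
        Real.exp (∑ e, v e) * G'.dualForestPoly p fun e => Real.exp (-v (φ.symm e)) := by
      intro p
      rw [G'.forestPoly_eq p (α := (fun e => Real.exp (v e)) ∘ φ.symm)
        (fun e => (Real.exp_pos _).ne'), ← Equiv.sum_comp φ.symm v, Real.exp_sum]
      simp only [Function.comp_apply, Real.exp_neg]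
    simp only [hΦ, hΦ', FeynmanGraph.pairForm, hpoly01, hpoly0z, hpoly1z, hrec, Real.exp_neg]
    field_simp
  have hsum : ∑ e, a e = (d : ℝ) / 2 * (G.intVerts.card + 1) := by
    rw [FeynmanGraph.Mdeg, Finset.mul_sum] at hM
    simp only [ha]
    linarith
  have hshift : ∀ (u : Fin nE → ℝ) (s : ℝ),
      (fun e => Real.exp ((u + fun _ => s : Fin nE → ℝ) e)) =
        fun e => Real.exp s * Real.exp (u e) := by
    intro u s
    funext e
    rw [Pi.add_apply, Real.exp_add, mul_comm]
  have hshift' : ∀ (u : Fin nE → ℝ) (s : ℝ),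
      (fun e => Real.exp (-(u + fun _ => s : Fin nE → ℝ) (φ.symm e))) =
        fun e => Real.exp (-s) * Real.exp (-u (φ.symm e)) := by
    intro u s
    funext e
    rw [Pi.add_apply, ← Real.exp_add, neg_add_rev]
  have hI := G.prod_Gamma_mul_posIntegral_eq_cutoff (by omega) hGconn h01 h0z h1z hext
    (fun e => (hpos e).1) one_pos hn0 hn1 hx01 hx0z hx1z
  have hI' := G'.prod_Gamma_mul_posIntegral_eq_cutoff (by omega) hG'conn h01' h0z' h1z' hext'
    hν' one_pos hn0 hn1 hx01' hx0z' hx1z'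
  rw [← hΦ] at hI
  rw [← hΦ', lintegral_comp_neg_equiv φ] at hI'
  have hintegrand : ∀ v : Fin nE → ℝ,
      Real.exp (∑ e, lam d * G'.ν e * -v (φ.symm e)) *
          (Φ' fun e => Real.exp (-v (φ.symm e))) ^ (-((d : ℝ) / 2)) =
        Real.exp (∑ e, a e * v e) * (Φ fun e => Real.exp (v e)) ^ (-((d : ℝ) / 2)) := by
    intro v
    rw [hdual, Real.mul_rpow (Real.exp_pos _).le (hΦpos v).le, ← mul_assoc, ← Real.exp_mul,
      ← Real.exp_add, ← Equiv.sum_comp φ]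
    simp only [hweight, Equiv.symm_apply_apply]
    congr 2
    rw [neg_mul_neg, Finset.sum_mul, ← Finset.sum_add_distrib]
    exact Finset.sum_congr rfl fun e _ => by ring
  simp only [hintegrand] at hI'
  have hψ : Measurable fun s : ℝ => ENNReal.ofReal (s ^ ((d : ℝ) / 2) * Real.exp (-s)) := by
    fun_prop
  have hC := lintegral_rpow_mul_exp_neg_exp hd0
  have hkey := lintegral_scale_invariant
    (F := fun u : Fin nE → ℝ => ENNReal.ofReal (Real.exp (∑ e, a e * u e) *
      (Φ fun e => Real.exp (u e)) ^ (-((d : ℝ) / 2))))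
    (h₁ := fun u => (Φ fun e => Real.exp (u e)) / (G.lapMinor G.ext fun e => Real.exp (u e)).det)
    (h₂ := fun u => (Φ' fun e => Real.exp (-u (φ.symm e))) /
      (G'.lapMinor G'.ext fun e => Real.exp (-u (φ.symm e))).det)
    (by fun_prop)
    ((hΦm.comp (by fun_prop)).div (hDm.comp (by fun_prop)))
    ((hΦm'.comp (by fun_prop)).div (hDm'.comp (by fun_prop))) hψ
    (fun u => div_pos (hΦpos u) (hDpos u))
    (fun u => div_pos (hΦpos' fun e => -u (φ.symm e)) (hDpos' fun e => -u (φ.symm e)))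
    (fun u s => by
      simp only [hshift]
      rw [hΦ, G.pairForm_smul h01 h0z h1z hext, ← hΦ,
        Real.mul_rpow (by positivity) (hΦpos u).le, ← mul_assoc, ← Real.exp_nat_mul,
        ← Real.exp_mul, ← Real.exp_add]
      simp only [Pi.add_apply, mul_add, Finset.sum_add_distrib, ← Finset.sum_mul, hsum]
      congr 3
      push_cast
      ring)
    (fun u s => by
      have hD := (hDpos u).ne'
      simp only [hshift]
      rw [hΦ, G.pairForm_smul h01 h0z h1z hext, ← hΦ, G.det_lapMinor_smul, pow_succ]
      field_simp)
    (fun u s => by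
      have hD := (hDpos' fun e => -u (φ.symm e)).ne'
      simp only [hshift']
      rw [hΦ', G'.pairForm_smul h01' h0z' h1z' hext', ← hΦ', G'.det_lapMinor_smul, pow_succ]
      field_simp)
    (by rw [hC]; exact (ENNReal.ofReal_pos.2 (Real.Gamma_pos_of_pos hd0)).ne')
    (by rw [hC]; exact ENNReal.ofReal_ne_top)
  have hmain := hI'.trans (hkey.symm.trans hI.symm)
  have hΓ' : ∏ e, Real.Gamma (lam d * G'.ν e) =
      ∏ e, Real.Gamma ((d : ℝ) / 2 - lam d * G.ν e) := by
    rw [← Equiv.prod_comp φ]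
    simp only [hweight]
  have hΓpos : 0 < ∏ e, Real.Gamma ((d : ℝ) / 2 - lam d * G.ν e) :=
    Finset.prod_pos fun e _ => Real.Gamma_pos_of_pos (sub_pos.2 (hpos e).2)
  rw [hΓ'] at hmain
  rw [FeynmanGraph.graphicalFn, FeynmanGraph.graphicalFn, Finset.prod_div_distrib,
    ENNReal.ofReal_div_of_pos hΓpos, ← mul_div_assoc,
    ENNReal.eq_div_iff (ENNReal.ofReal_pos.2 hΓpos).ne' ENNReal.ofReal_ne_top, hmain, mul_comm]
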